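/- arXiv:math/0507180 — 2 statements merged into one kernel-verified Lean document; each statement's English description precedes it below -/
import Mathlib

section
/- Let d ≥ 1 be an integer and let L, β, α be positive constants. Then there exist values of the parameters C0, c0, r0, μ_max > 0, a compact C ⊂ R^d, and a constant C > 0 such that for every n ≥ 1 and every classifier f̂_n (any measurable function of the sample (X_1,Y_1),…,(X_n,Y_n) with values in decision rules), sup_{P ∈ P_Σ'(α, C0, β, L, c0, r0, μ_max, C)} { E[R(f̂_n)] − R(f*) } ≥ C n^{−(1+α)β/((2+α)β+d)}, where P_Σ' is the class of all distributions P on R^d × {0,1} satisfying the margin assumption MA(α, C0), η ∈ Σ(β, L, R^d), and the mild density assumption. -/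
open MeasureTheory Metric Set
open scoped ENNReal NNReal

noncomputable section

/-- Feature space: `ℝ^d` with the Euclidean norm. -/
abbrev Euc (d : ℕ) := EuclideanSpace ℝ (Fin d)

/-- A sample of size `n`: `n` points of `ℝ^d × {0,1}` (labels modelled by `Bool`). -/
abbrev Sample (d n : ℕ) := Fin n → Euc d × Bool

/-- Joint law of `(X,Y)` determined by the marginal `PX` and the regression
function `η(x) = P(Y = 1 | X = x)`. -/
def jointLaw {d : ℕ} (PX : Measure (Euc d)) (η : Euc d → ℝ) : Measure (Euc d × Bool) :=
  PX.bind fun x =>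
    ENNReal.ofReal (η x) • Measure.dirac (x, true) +
      ENNReal.ofReal (1 - η x) • Measure.dirac (x, false)

/-- Law `P^{⊗n}` of an i.i.d. sample of size `n`. -/
def sampleLaw {d : ℕ} (PX : Measure (Euc d)) (η : Euc d → ℝ) (n : ℕ) :
    Measure (Sample d n) :=
  Measure.pi fun _ => jointLaw PX η

/-- Misclassification risk `R(f) = P(Y ≠ f(X))` of a decision rule `f`. -/
def risk {d : ℕ} (PX : Measure (Euc d)) (η : Euc d → ℝ) (f : Euc d → Bool) : ℝ :=
  ∫ x, (if f x then 1 - η x else η x) ∂PX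

/-- The Bayes rule `f*(x) = 1{η(x) ≥ 1/2}`. -/
def bayes {d : ℕ} (η : Euc d → ℝ) : Euc d → Bool := fun x => decide ((1 : ℝ) / 2 ≤ η x)

/-- The plug-in rule `1{g ≥ 1/2}` associated with a function `g`. -/
def plugin {d : ℕ} (g : Euc d → ℝ) : Euc d → Bool := fun x => decide ((1 : ℝ) / 2 ≤ g x)

/-- Margin (low noise) assumption MA(α, C0):
`P_X(0 < |η(X) − 1/2| ≤ t) ≤ C0 t^α` for all `t > 0`. -/
def Margin {d : ℕ} (PX : Measure (Euc d)) (η : Euc d → ℝ) (α C0 : ℝ) : Prop :=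
  ∀ t : ℝ, 0 < t →
    PX {x | 0 < |η x - 1 / 2| ∧ |η x - 1 / 2| ≤ t} ≤ ENNReal.ofReal (C0 * t ^ α)

/-- Taylor polynomial of degree `N` of `g` at `x`, evaluated at `x'`. -/
def taylorPoly {d : ℕ} (g : Euc d → ℝ) (N : ℕ) (x x' : Euc d) : ℝ :=
  ∑ k ∈ Finset.range (N + 1), (k.factorial : ℝ)⁻¹ * iteratedFDeriv ℝ k g x (fun _ => x' - x)

/-- The Hölder class `Σ(β, L, ℝ^d)`: `g` is `⌊β⌋` times continuously differentiable
(`⌊β⌋` = largest integer strictly less than `β`, i.e. `⌈β⌉₊ - 1` for `β > 0`) and its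
Taylor polynomial of degree `⌊β⌋` approximates it to order `L‖x − x'‖^β`. -/
def HolderClass {d : ℕ} (β L : ℝ) (g : Euc d → ℝ) : Prop :=
  ContDiff ℝ (⌈β⌉₊ - 1 : ℕ) g ∧
    ∀ x x' : Euc d, |g x' - taylorPoly g (⌈β⌉₊ - 1) x x'| ≤ L * ‖x' - x‖ ^ β

/-- `(c0, r0)`-regularity of a set `A`:
`λ[A ∩ B(x,r)] ≥ c0 λ[B(x,r)]` for all `0 < r ≤ r0` and `x ∈ A`. -/
def Regular {d : ℕ} (c0 r0 : ℝ) (A : Set (Euc d)) : Prop :=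
  ∀ x ∈ A, ∀ r : ℝ, 0 < r → r ≤ r0 →
    ENNReal.ofReal c0 * volume (closedBall x r) ≤ volume (A ∩ closedBall x r)

/-- Strong density assumption with parameters `(c0, r0, μmin, μmax, K)`. -/
def StrongDensity {d : ℕ} (PX : Measure (Euc d)) (c0 r0 μmin μmax : ℝ)
    (K : Set (Euc d)) : Prop :=
  ∃ A : Set (Euc d), IsCompact A ∧ A ⊆ K ∧ Regular c0 r0 A ∧
    ∃ μ : Euc d → ℝ, Measurable μ ∧ (∀ x ∈ A, μmin ≤ μ x ∧ μ x ≤ μmax) ∧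
      (∀ x, x ∉ A → μ x = 0) ∧
      PX = volume.withDensity fun x => ENNReal.ofReal (μ x)

/-- Mild density assumption with parameters `(c0, r0, μmax, K)`. -/
def MildDensity {d : ℕ} (PX : Measure (Euc d)) (c0 r0 μmax : ℝ)
    (K : Set (Euc d)) : Prop :=
  ∃ A : Set (Euc d), IsCompact A ∧ A ⊆ K ∧ Regular c0 r0 A ∧
    ∃ μ : Euc d → ℝ, Measurable μ ∧ (∀ x ∈ A, 0 ≤ μ x ∧ μ x ≤ μmax) ∧
      (∀ x, x ∉ A → μ x = 0) ∧
      PX = volume.withDensity fun x => ENNReal.ofReal (μ x)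

/-- The class `P_Σ(α, C0, β, L, c0, r0, μmin, μmax, K)`, a distribution being encoded
by its marginal `PX` together with its regression function `η`. -/
def MemPS {d : ℕ} (α C0 β L c0 r0 μmin μmax : ℝ) (K : Set (Euc d))
    (PX : Measure (Euc d)) (η : Euc d → ℝ) : Prop :=
  IsProbabilityMeasure PX ∧ Measurable η ∧ (∀ x, η x ∈ Icc (0 : ℝ) 1) ∧
    Margin PX η α C0 ∧ HolderClass β L η ∧ StrongDensity PX c0 r0 μmin μmax K

/-- Topological support of a measure on `ℝ^d`. -/
def msupport {d : ℕ} (PX : Measure (Euc d)) : Set (Euc d) :=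
  {x | ∀ r : ℝ, 0 < r → 0 < PX (ball x r)}

/-- `f` hits the level `a` at `x0`. -/
def Hits {d : ℕ} (f : Euc d → ℝ) (a : ℝ) (x0 : Euc d) : Prop :=
  f x0 = a ∧ ∀ r : ℝ, 0 < r → ∃ x ∈ closedBall x0 r, f x ≠ a

/-- `f` crosses the level `a` at `x0`. -/
def Crosses {d : ℕ} (f : Euc d → ℝ) (a : ℝ) (x0 : Euc d) : Prop :=
  ∀ r : ℝ, 0 < r → (∃ x ∈ closedBall x0 r, f x < a) ∧ ∃ x ∈ closedBall x0 r, a < f x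

/-- Expected excess risk `E[R(f̂_n)] − R(f*)` of a plug-in classifier built from the
estimator `hatη` of the regression function. -/
def expExcess {d : ℕ} (PX : Measure (Euc d)) (η : Euc d → ℝ) {n : ℕ}
    (hatη : Sample d n → Euc d → ℝ) : ℝ :=
  (∫ ω, risk PX η (plugin (hatη ω)) ∂sampleLaw PX η n) - risk PX η (bayes η)

/-- Expected excess risk `E[R(f̂_n)] − R(f*)` of a (general) classifier. -/
def expExcessRule {d : ℕ} (PX : Measure (Euc d)) (η : Euc d → ℝ) {n : ℕ}
    (fhat : Sample d n → Euc d → Bool) : ℝ :=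
  (∫ ω, risk PX η (fhat ω) ∂sampleLaw PX η n) - risk PX η (bayes η)

/-- Empirical misclassification risk of the plug-in rule `1{g ≥ 1/2}` on a sample. -/
def empRisk {d n : ℕ} (ω : Sample d n) (g : Euc d → ℝ) : ℝ :=
  (n : ℝ)⁻¹ * ∑ i : Fin n, if plugin g (ω i).1 ≠ (ω i).2 then (1 : ℝ) else 0

lemma taylor_rem_bound {d : ℕ} {β M : ℝ} (hβ : 0 < β) (u : Euc d → ℝ)
    (hu : ContDiff ℝ ((⌈β⌉₊ - 1 : ℕ) + 1) u)
    (hM : ∀ k ≤ (⌈β⌉₊ - 1) + 1, ∀ x, ‖iteratedFDeriv ℝ k u x‖ ≤ M) (x x' : Euc d) :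
    |u x' - taylorPoly u (⌈β⌉₊ - 1) x x'| ≤ ((⌈β⌉₊ : ℝ) + 1) * M * ‖x' - x‖ ^ β := by
  set N := ⌈β⌉₊ - 1 with hN
  have hc : 1 ≤ ⌈β⌉₊ := Nat.one_le_iff_ne_zero.2 (Nat.ceil_pos.2 hβ).ne'
  have hNc : (N : ℝ) + 1 = ⌈β⌉₊ := by
    rw [hN]; push_cast [Nat.cast_sub hc]; ring
  have hβN : β ≤ N + 1 := by rw [hNc]; exact Nat.le_ceil β
  have hNβ : (N : ℝ) ≤ β := by
    have := Nat.ceil_lt_add_one hβ.le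
    linarith
  rw [← hNc]
  have hM0 : 0 ≤ M := (norm_nonneg _).trans (hM 0 (by omega) x)
  set r := ‖x' - x‖ with hr
  have hr0 : 0 ≤ r := norm_nonneg _
  have happ : ∀ k ≤ N + 1, ∀ z, |iteratedFDeriv ℝ k u z (fun _ => x' - x)| ≤ M * r ^ k := by
    intro k hk z
    have := (iteratedFDeriv ℝ k u z).le_opNorm (fun _ => x' - x)
    rw [Real.norm_eq_abs] at this
    refine this.trans ?_
    simp only [Finset.prod_const, Finset.card_univ, Fintype.card_fin]
    exact mul_le_mul_of_nonneg_right (hM k hk z) (by positivity)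
  rcases le_total r 1 with h1 | h1
  · have key := map_add_eq_sum_add_integral_iteratedFDeriv (f := u) (x := x) (y := x' - x) (n := N)
      (fun t _ => hu.contDiffAt)
    have e1 : u x' - taylorPoly u N x x' = (N.factorial : ℝ)⁻¹ • ∫ t in (0:ℝ)..1,
        (1 - t)^N • iteratedFDeriv ℝ (N + 1) u (x + t • (x' - x)) (fun _ ↦ x' - x) := by
      rw [add_sub_cancel] at key
      rw [key]; simp only [taylorPoly, smul_eq_mul]; ring
    rw [e1]
    have hIntg : ‖∫ t in (0:ℝ)..1,
        (1 - t)^N • iteratedFDeriv ℝ (N + 1) u (x + t • (x' - x)) (fun _ ↦ x' - x)‖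
        ≤ (M * r ^ (N+1)) * |1 - 0| := by
      apply intervalIntegral.norm_integral_le_of_norm_le_const
      intro t ht
      rw [uIoc_of_le zero_le_one] at ht
      rw [norm_smul, Real.norm_eq_abs, Real.norm_eq_abs, abs_pow]
      have h2 : |1 - t| ^ N ≤ 1 := by
        apply pow_le_one₀ (abs_nonneg _)
        rw [abs_le]; constructor <;> linarith [ht.1, ht.2]
      calc _ ≤ 1 * |_| := mul_le_mul_of_nonneg_right h2 (abs_nonneg _)
        _ ≤ _ := by rw [one_mul]; exact happ _ le_rfl _
    rw [smul_eq_mul, abs_mul]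
    rw [Real.norm_eq_abs] at hIntg
    have h3 : |((N.factorial : ℝ))⁻¹| ≤ 1 := by
      rw [abs_of_nonneg (by positivity)]
      apply inv_le_one_of_one_le₀
      exact_mod_cast N.factorial_pos
    have h4 : r ^ (N+1) ≤ r ^ β := by
      rcases hr0.eq_or_lt with h0 | h0
      · rw [← h0, Real.zero_rpow hβ.ne', zero_pow (by omega)]
      · rw [← Real.rpow_natCast]
        exact Real.rpow_le_rpow_of_exponent_ge h0 h1 (by push_cast; exact hβN)
    have h5 : 0 ≤ r ^ β := by positivity
    calc _ ≤ 1 * (M * r ^ (N+1)) := by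
            apply mul_le_mul h3 (by simpa using hIntg) (abs_nonneg _) zero_le_one
      _ ≤ 1 * (M * r ^ β) := by gcongr
      _ ≤ _ := by
        have : 0 ≤ M * r ^ β := by positivity
        have hN0 : (0:ℝ) ≤ N := by positivity
        nlinarith
  · have h5 : 1 ≤ r ^ β := Real.one_le_rpow h1 hβ.le
    have hu' : |u x'| ≤ M * r ^ β := by
      have := hM 0 (by omega) x'
      rw [norm_iteratedFDeriv_zero, Real.norm_eq_abs] at this
      nlinarith
    have hT : |taylorPoly u N x x'| ≤ (N + 1) * (M * r ^ β) := by
      unfold taylorPoly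
      refine (Finset.abs_sum_le_sum_abs _ _).trans ?_
      calc _ ≤ ∑ k ∈ Finset.range (N + 1), M * r ^ β := by
            apply Finset.sum_le_sum
            intro k hk
            have hk' : k ≤ N := by simpa [Nat.lt_succ_iff] using hk
            rw [abs_mul]
            have h3 : |((k.factorial : ℝ))⁻¹| ≤ 1 := by
              rw [abs_of_nonneg (by positivity)]
              apply inv_le_one_of_one_le₀
              exact_mod_cast k.factorial_pos
            have h4 : r ^ k ≤ r ^ β := by
              rw [← Real.rpow_natCast]
              exact Real.rpow_le_rpow_of_exponent_le h1
                ((Nat.cast_le.2 hk').trans hNβ)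
            calc _ ≤ 1 * (M * r ^ k) :=
                  mul_le_mul h3 (happ k (by omega) x) (abs_nonneg _) zero_le_one
              _ ≤ _ := by rw [one_mul]; gcongr
        _ = _ := by simp
    calc _ ≤ |u x'| + |taylorPoly u N x x'| := abs_sub _ _
      _ ≤ _ := by nlinarith

lemma taylorPoly_affine {d : ℕ} (u : Euc d → ℝ) (N : ℕ) (hu : ContDiff ℝ N u) (c a q : ℝ)
    (x x' : Euc d) :
    taylorPoly (fun x => c + a * u (q • x)) N x x' =
      c + a * taylorPoly u N (q • x) (q • x') := by
  unfold taylorPoly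
  have hk : ∀ k ∈ Finset.range (N+1), ∀ v, iteratedFDeriv ℝ k (fun x => c + a * u (q • x)) x v
      = (if k = 0 then c else 0) + a * (q ^ k * iteratedFDeriv ℝ k u (q • x) v) := by
    intro k hk v
    have hkN : k ≤ N := by simpa [Nat.lt_succ_iff] using hk
    have huk : ContDiff ℝ k u := hu.of_le (by exact_mod_cast hkN)
    have h1 : ContDiff ℝ k (fun x => u (q • x)) := huk.comp (contDiff_id.const_smul q)
    have h2 : ContDiff ℝ k (fun x => a • u (q • x)) := h1.const_smul a
    have e : (fun x : Euc d => c + a * u (q • x)) = (fun _ => c) + (fun x => a • u (q • x)) := rfl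
    rw [e, iteratedFDeriv_add_apply contDiff_const.contDiffAt h2.contDiffAt,
      iteratedFDeriv_const_smul_apply' h1.contDiffAt, iteratedFDeriv_comp_const_smul _ huk]
    rcases Nat.eq_zero_or_pos k with rfl | h0
    · simp
    · rw [iteratedFDeriv_const_of_ne (by omega)]
      simp [h0.ne']
  rw [Finset.sum_congr rfl (fun k hk' => by rw [hk k hk' _])]
  have hmul : ∀ k, iteratedFDeriv ℝ k u (q • x) (fun _ => q • x' - q • x) =
      q ^ k * iteratedFDeriv ℝ k u (q • x) (fun _ => x' - x) := by
    intro k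
    rw [← smul_sub]
    have := (iteratedFDeriv ℝ k u (q • x)).map_smul_univ (fun _ => q) (fun _ => x' - x)
    simpa using this
  simp only [hmul, mul_add, Finset.sum_add_distrib, Finset.mul_sum]
  congr 1
  · rw [Finset.sum_eq_single 0]
    · simp
    · intro b _ hb; simp [hb]
    · simp
  · apply Finset.sum_congr rfl
    intros; ring

lemma holder_scaled {d : ℕ} {β L M : ℝ} (hβ : 0 < β) (u : Euc d → ℝ)
    (hu : ContDiff ℝ ((⌈β⌉₊ - 1 : ℕ) + 1) u)
    (hM : ∀ k ≤ (⌈β⌉₊ - 1) + 1, ∀ x, ‖iteratedFDeriv ℝ k u x‖ ≤ M)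
    (c q : ℝ) (hq : 0 < q) (hc : 0 ≤ c) (hL : c * (((⌈β⌉₊ : ℝ) + 1) * M) ≤ L) :
    HolderClass β L (fun x => 1 / 2 + c * q ^ (-β) * u (q • x)) := by
  have huN : ContDiff ℝ (⌈β⌉₊ - 1 : ℕ) u := hu.of_le (by exact_mod_cast Nat.le_succ _)
  refine ⟨?_, fun x x' => ?_⟩
  · exact contDiff_const.add (contDiff_const.mul (huN.comp (contDiff_id.const_smul q)))
  · rw [taylorPoly_affine _ _ huN]
    have h := taylor_rem_bound hβ u hu hM (q • x) (q • x')
    have e : ‖q • x' - q • x‖ ^ β = q ^ β * ‖x' - x‖ ^ β := by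
      rw [← smul_sub, norm_smul, Real.norm_of_nonneg hq.le,
        Real.mul_rpow hq.le (norm_nonneg _)]
    rw [e] at h
    have hqq : q ^ (-β) * q ^ β = 1 := by
      rw [← Real.rpow_add hq]; simp
    have hq' : 0 < q ^ (-β) := by positivity
    have e2 : (1 / 2 + c * q ^ (-β) * u (q • x') -
        (1 / 2 + c * q ^ (-β) * taylorPoly u (⌈β⌉₊ - 1) (q • x) (q • x'))) =
        (c * q ^ (-β)) * (u (q • x') - taylorPoly u (⌈β⌉₊ - 1) (q • x) (q • x')) := by ring
    rw [e2, abs_mul, abs_of_nonneg (by positivity : 0 ≤ c * q ^ (-β))]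
    calc _ ≤ (c * q ^ (-β)) * ((⌈β⌉₊ + 1) * M * (q ^ β * ‖x' - x‖ ^ β)) := by gcongr
      _ = (q ^ (-β) * q ^ β) * (c * ((⌈β⌉₊ + 1) * M)) * ‖x' - x‖ ^ β := by ring
      _ ≤ L * ‖x' - x‖ ^ β := by
        rw [hqq, one_mul]; gcongr

/-- Sign of a Boolean. -/
def sg (b : Bool) : ℝ := if b then 1 else -1

lemma abs_sg (b : Bool) : |sg b| = 1 := by cases b <;> simp [sg]

/-- Integer grid points. -/
def grid {d q : ℕ} (j : Fin d → Fin q) : Euc d := WithLp.toLp 2 (fun i => ((j i : ℕ) : ℝ))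

lemma grid_dist {d q : ℕ} {j k : Fin d → Fin q} (h : j ≠ k) : 1 ≤ dist (grid j) (grid k) := by
  obtain ⟨i, hi⟩ := Function.ne_iff.1 h
  have h1 : dist ((grid j) i) ((grid k) i) ≤ dist (grid j) (grid k) := by
    rw [dist_eq_norm, dist_eq_norm]
    exact PiLp.norm_apply_le (grid j - grid k) i
  refine le_trans ?_ h1
  have hi' : ((j i : ℕ) : ℤ) ≠ ((k i : ℕ) : ℤ) := by
    intro h; apply hi; ext; exact_mod_cast h
  have : (1 : ℤ) ≤ |((j i : ℕ) : ℤ) - ((k i : ℕ) : ℤ)| := Int.one_le_abs (sub_ne_zero.2 hi')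
  rw [Real.dist_eq]
  show (1:ℝ) ≤ |((j i : ℕ) : ℝ) - ((k i : ℕ) : ℝ)|
  exact_mod_cast this

lemma grid_norm {d q : ℕ} (j : Fin d → Fin q) : ‖grid j‖ ≤ q * d := by
  have h : ‖grid j‖ ≤ ∑ i, ‖(grid j) i‖ := by
    rw [EuclideanSpace.norm_eq]
    refine Real.sqrt_le_iff.2 ⟨by positivity, ?_⟩
    exact Finset.sum_sq_le_sq_sum_of_nonneg (fun i _ => norm_nonneg _)
  refine h.trans ?_
  calc _ ≤ ∑ i : Fin d, (q : ℝ) := by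
        apply Finset.sum_le_sum
        intro i _
        show ‖((j i : ℕ) : ℝ)‖ ≤ q
        rw [Real.norm_natCast]
        exact_mod_cast (j i).2.le
    _ = _ := by simp [mul_comm]

lemma grid_unique {d q : ℕ} {x : Euc d} {j k : Fin d → Fin q} (hj : dist x (grid j) ≤ 1 / 3)
    (hk : dist x (grid k) ≤ 1 / 3) : j = k := by
  by_contra h
  have := grid_dist h
  have h2 := dist_triangle_left (grid j) (grid k) x
  linarith

lemma exists_bump (d N : ℕ) : ∃ (φ : Euc d → ℝ) (M : ℝ), ContDiff ℝ (N : ℕ) φ ∧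
    (∀ x, ‖x‖ ≤ 1 / 4 → φ x = 1) ∧ (∀ x, |φ x| ≤ 1) ∧
    (∀ k ≤ N, ∀ x, ‖iteratedFDeriv ℝ k φ x‖ ≤ M) ∧
    (∀ k ≤ N, ∀ x, 1 / 3 < ‖x‖ → iteratedFDeriv ℝ k φ x = 0) ∧ 0 < M := by
  let f : ContDiffBump (0 : Euc d) := ⟨1 / 4, 1 / 3, by norm_num, by norm_num⟩
  have hcd : ContDiff ℝ (N : ℕ) f := f.contDiff
  have hbd : ∀ k, k ≤ N → ∃ C, ∀ x, ‖iteratedFDeriv ℝ k f x‖ ≤ C := by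
    intro k hk
    have hcs : HasCompactSupport (iteratedFDeriv ℝ k f) := f.hasCompactSupport.iteratedFDeriv k
    exact hcs.exists_bound_of_continuous
      (hcd.continuous_iteratedFDeriv (by exact_mod_cast hk))
  choose! C hC using hbd
  refine ⟨f, 1 + ∑ k ∈ Finset.range (N+1), |C k|, hcd, ?_, ?_, ?_, ?_, ?_⟩
  · intro x hx
    exact f.one_of_mem_closedBall (by simpa [f] using hx)
  · intro x; rw [abs_of_nonneg f.nonneg]; exact f.le_one
  · intro k hk x
    have : |C k| ≤ ∑ k ∈ Finset.range (N+1), |C k| :=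
      Finset.single_le_sum (f := fun k => |C k|) (fun i _ => abs_nonneg _)
        (Finset.mem_range.2 (by omega))
    linarith [hC k hk x, le_abs_self (C k)]
  · intro k hk x hx
    by_contra h
    have : x ∈ tsupport f := support_iteratedFDeriv_subset k h
    rw [f.tsupport_eq] at this
    have h2 : ‖x‖ ≤ 1 / 3 := by simpa [f] using this
    linarith
  · positivity

/-- Sum of signed bumps. -/
def bumpSum {d q : ℕ} (φ : Euc d → ℝ) (σ : (Fin d → Fin q) → Bool) (x : Euc d) : ℝ :=
  ∑ j, sg (σ j) * φ (x - grid j)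

section bumps
variable {d q N : ℕ} {φ : Euc d → ℝ} {M : ℝ}

lemma bumpSum_contDiff (hφ : ContDiff ℝ (N : ℕ) φ) (σ : (Fin d → Fin q) → Bool) :
    ContDiff ℝ (N : ℕ) (bumpSum φ σ) := by
  unfold bumpSum
  exact ContDiff.sum fun j _ => contDiff_const.mul (hφ.comp (contDiff_id.sub contDiff_const))

lemma bumpSum_deriv (hφ : ContDiff ℝ (N : ℕ) φ) (hM0 : 0 < M)
    (hM : ∀ k ≤ N, ∀ x, ‖iteratedFDeriv ℝ k φ x‖ ≤ M)
    (h0 : ∀ k ≤ N, ∀ x, 1 / 3 < ‖x‖ → iteratedFDeriv ℝ k φ x = 0)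
    (σ : (Fin d → Fin q) → Bool) (k : ℕ) (hk : k ≤ N) (x : Euc d) :
    ‖iteratedFDeriv ℝ k (bumpSum φ σ) x‖ ≤ M := by
  have hφk : ContDiff ℝ k φ := hφ.of_le (by exact_mod_cast hk)
  have hs : ∀ j : Fin d → Fin q, ContDiff ℝ k (fun x => φ (x - grid j)) := fun j =>
    hφk.comp (contDiff_id.sub contDiff_const)
  have e : iteratedFDeriv ℝ k (bumpSum φ σ) x =
      ∑ j, sg (σ j) • iteratedFDeriv ℝ k φ (x - grid j) := by
    have : bumpSum φ σ = fun x => ∑ j, sg (σ j) • φ (x - grid j) := rfl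
    rw [this, iteratedFDeriv_fun_sum_apply
      (fun j _ => ((hs j).const_smul (sg (σ j))).contDiffAt)]
    apply Finset.sum_congr rfl
    intro j _
    rw [iteratedFDeriv_const_smul_apply' (hs j).contDiffAt, iteratedFDeriv_comp_sub]
  rw [e]
  by_cases h : ∃ j : Fin d → Fin q, dist x (grid j) ≤ 1 / 3
  · obtain ⟨j, hj⟩ := h
    rw [Finset.sum_eq_single j]
    · rw [norm_smul, Real.norm_eq_abs, abs_sg, one_mul]; exact hM k hk _
    · intro i _ hi
      rw [h0 k hk, smul_zero]
      by_contra hc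
      rw [← dist_eq_norm, not_lt] at hc
      exact hi (grid_unique hc hj)
    · simp
  · push Not at h
    rw [Finset.sum_eq_zero]
    · simpa using hM0.le
    · intro j _
      rw [h0 k hk, smul_zero]
      rw [← dist_eq_norm]; exact h j

lemma phi_zero (h0 : ∀ k ≤ N, ∀ x, 1 / 3 < ‖x‖ → iteratedFDeriv ℝ k φ x = 0) (x : Euc d)
    (hx : 1 / 3 < ‖x‖) : φ x = 0 := by
  have := h0 0 (Nat.zero_le _) x hx
  have h2 : iteratedFDeriv ℝ 0 φ x (fun _ => 0) = 0 := by rw [this]; rfl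
  simpa using h2

lemma bumpSum_near (h0 : ∀ x, 1 / 3 < ‖x‖ → φ x = 0)
    (σ : (Fin d → Fin q) → Bool) (x : Euc d) (j : Fin d → Fin q) (hj : dist x (grid j) ≤ 1 / 3) :
    bumpSum φ σ x = sg (σ j) * φ (x - grid j) := by
  unfold bumpSum
  rw [Finset.sum_eq_single j]
  · intro i _ hi
    rw [h0, mul_zero]
    by_contra hc
    rw [← dist_eq_norm, not_lt] at hc
    exact hi (grid_unique hc hj)
  · simp

lemma bumpSum_far (h0 : ∀ x, 1 / 3 < ‖x‖ → φ x = 0)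
    (σ : (Fin d → Fin q) → Bool) (x : Euc d) (h : ∀ j : Fin d → Fin q, 1 / 3 < dist x (grid j)) :
    bumpSum φ σ x = 0 := by
  unfold bumpSum
  apply Finset.sum_eq_zero
  intro j _
  rw [h0, mul_zero]
  rw [← dist_eq_norm]; exact h j

lemma bumpSum_abs (h0 : ∀ x, 1 / 3 < ‖x‖ → φ x = 0) (h1 : ∀ x, |φ x| ≤ 1)
    (σ : (Fin d → Fin q) → Bool) (x : Euc d) : |bumpSum φ σ x| ≤ 1 := by
  by_cases h : ∃ j : Fin d → Fin q, dist x (grid j) ≤ 1 / 3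
  · obtain ⟨j, hj⟩ := h
    rw [bumpSum_near h0 σ x j hj, abs_mul, abs_sg, one_mul]; exact h1 _
  · push Not at h
    rw [bumpSum_far h0 σ x h]; simp

end bumps

lemma pi_withDensity_ofReal {Z : Type*} [MeasurableSpace Z] (P : Measure Z) [IsProbabilityMeasure P]
    (g : Z → ℝ) (hg : Measurable g) (hg0 : ∀ z, 0 ≤ g z) (hg2 : ∀ z, g z ≤ 2) (n : ℕ) :
    Measure.pi (fun _ : Fin n => P.withDensity (fun z => ENNReal.ofReal (g z))) =
      (Measure.pi (fun _ : Fin n => P)).withDensity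
        (fun ω => ENNReal.ofReal (∏ i, g (ω i))) := by
  have hgi : Integrable g P := Integrable.of_bound hg.aestronglyMeasurable 2
    (Filter.Eventually.of_forall fun z => by rw [Real.norm_of_nonneg (hg0 z)]; exact hg2 z)
  apply Measure.pi_eq
  intro s hs
  rw [withDensity_apply _ (MeasurableSet.univ_pi hs)]
  have e1 : ∀ i, P.withDensity (fun z => ENNReal.ofReal (g z)) (s i) =
      ENNReal.ofReal (∫ z, (s i).indicator g z ∂P) := by
    intro i
    rw [withDensity_apply _ (hs i), integral_indicator (hs i),
      ofReal_integral_eq_lintegral_ofReal hgi.integrableOn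
        (Filter.Eventually.of_forall hg0)]
  have hind0 : ∀ i z, 0 ≤ (s i).indicator g z := fun i z =>
    Set.indicator_nonneg (fun z _ => hg0 z) z
  rw [Finset.prod_congr rfl (fun i _ => e1 i),
    ← ENNReal.ofReal_prod_of_nonneg (fun i _ => integral_nonneg (hind0 i)),
    ← integral_fintype_prod_eq_prod (fun i z => (s i).indicator g z),
    ofReal_integral_eq_lintegral_ofReal, ← lintegral_indicator (MeasurableSet.univ_pi hs)]
  · congr 1
    ext ω
    by_cases h : ω ∈ univ.pi s
    · rw [Set.indicator_of_mem h]
      congr 1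
      apply Finset.prod_congr rfl
      intro i _
      rw [Set.indicator_of_mem (h i (mem_univ i))]
    · rw [Set.indicator_of_notMem h]
      simp only [Set.mem_pi, mem_univ, true_implies, not_forall] at h
      obtain ⟨i, hi⟩ := h
      rw [Finset.prod_eq_zero (Finset.mem_univ i), ENNReal.ofReal_zero]
      rw [Set.indicator_of_notMem hi]
  · apply Integrable.fintype_prod
    intro i
    exact hgi.indicator (hs i)
  · exact Filter.Eventually.of_forall fun ω => Finset.prod_nonneg fun i _ => hind0 i _

lemma prod_sq_dev {Z : Type*} [MeasurableSpace Z] (P : Measure Z) [IsProbabilityMeasure P]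
    (a : Z → ℝ) (ha : Measurable a) (ha1 : ∀ z, |a z| ≤ 1) (hm : ∫ z, a z ∂P = 0)
    (s : ℝ) (hs : ∫ z, a z ^ 2 ∂P ≤ s) (n : ℕ) (hns : n * s ≤ 1 / 32) :
    Integrable (fun ω : Fin n → Z => ∏ i, (1 + a (ω i))) (Measure.pi fun _ => P) ∧
    Integrable (fun ω : Fin n → Z => (∏ i, (1 + a (ω i)) - 1) ^ 2) (Measure.pi fun _ => P) ∧
    ∫ ω : Fin n → Z, (∏ i, (1 + a (ω i)) - 1) ^ 2 ∂(Measure.pi fun _ => P) ≤ 1 / 31 := by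
  have hai : Integrable a P := Integrable.of_bound ha.aestronglyMeasurable 1
    (Filter.Eventually.of_forall fun z => ha1 z)
  have ha2 : Integrable (fun z => a z ^ 2) P :=
    Integrable.of_bound (ha.pow_const 2).aestronglyMeasurable 1
    (Filter.Eventually.of_forall fun z => by
      rw [norm_pow, Real.norm_eq_abs]; exact pow_le_one₀ (abs_nonneg _) (ha1 z))
  have h1 : Integrable (fun z => 1 + a z) P := (integrable_const 1).add hai
  have h2 : Integrable (fun z => (1 + a z) ^ 2) P := by
    have : (fun z => (1 + a z) ^ 2) = fun z => 1 + 2 * a z + a z ^ 2 := by ext; ring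
    rw [this]
    exact ((integrable_const 1).add (hai.const_mul 2)).add ha2
  have I1 : Integrable (fun ω : Fin n → Z => ∏ i, (1 + a (ω i))) (Measure.pi fun _ => P) :=
    Integrable.fintype_prod (f := fun _ z => 1 + a z) fun _ => h1
  have I2 : Integrable (fun ω : Fin n → Z => ∏ i, (1 + a (ω i)) ^ 2) (Measure.pi fun _ => P) :=
    Integrable.fintype_prod (f := fun _ z => (1 + a z) ^ 2) fun _ => h2
  have e : (fun ω : Fin n → Z => (∏ i, (1 + a (ω i)) - 1) ^ 2) =
      fun ω => (∏ i, (1 + a (ω i)) ^ 2 - 2 * ∏ i, (1 + a (ω i))) + 1 := by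
    ext ω; rw [Finset.prod_pow]; ring
  have I3 := (I2.sub (I1.const_mul 2)).add (integrable_const (1:ℝ))
  refine ⟨I1, by rw [e]; exact I3, ?_⟩
  have IS : Integrable (fun ω : Fin n → Z => ∏ i, (1 + a (ω i)) ^ 2 - 2 * ∏ i, (1 + a (ω i)))
      (Measure.pi fun _ => P) := I2.sub (I1.const_mul 2)
  rw [e, integral_add IS (integrable_const _),
    integral_sub I2 (I1.const_mul 2), integral_const_mul,
    integral_fintype_prod_eq_pow (fun z => 1 + a z),
    integral_fintype_prod_eq_pow (fun z => (1 + a z) ^ 2)]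
  have v1 : ∫ z, (1 + a z) ∂P = 1 := by
    rw [integral_add (integrable_const _) hai, hm]; simp
  have v2 : ∫ z, (1 + a z) ^ 2 ∂P = 1 + ∫ z, a z ^ 2 ∂P := by
    have : (fun z => (1 + a z) ^ 2) = fun z => 1 + 2 * a z + a z ^ 2 := by ext; ring
    have IS' : Integrable (fun z => 1 + 2 * a z) P := (integrable_const 1).add (hai.const_mul 2)
    rw [this, integral_add IS' ha2,
      integral_add (integrable_const 1) (hai.const_mul 2), integral_const_mul, hm]
    simp
  rw [v1, v2]
  have hs0 : 0 ≤ ∫ z, a z ^ 2 ∂P := integral_nonneg fun z => sq_nonneg _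
  set t := ∫ z, a z ^ 2 ∂P
  have ht1 : t ≤ 1 := by
    calc t ≤ ∫ z, (1:ℝ) ∂P := integral_mono ha2 (integrable_const _) fun z => by
          have := pow_le_one₀ (abs_nonneg _) (ha1 z) (n := 2)
          simpa using this
      _ = 1 := by simp
  have b1 : 1 + (n:ℝ) * (-t) ≤ (1 + (-t)) ^ n := one_add_mul_le_pow (by linarith) n
  have b2 : (1 + t) ^ n * (1 + (-t)) ^ n ≤ 1 := by
    rw [← mul_pow]
    apply pow_le_one₀ <;> nlinarith
  have b3 : (n:ℝ) * t ≤ 1 / 32 := (mul_le_mul_of_nonneg_left hs (Nat.cast_nonneg n)).trans hns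
  have b4 : 0 ≤ (1 + t) ^ n := by positivity
  have b5 : (1 + t) ^ n ≤ 32 / 31 := by nlinarith
  simp
  linarith

lemma two_point {Z : Type*} [MeasurableSpace Z] (P : Measure Z) [IsProbabilityMeasure P]
    (a : Z → ℝ) (ha : Measurable a) (ha1 : ∀ z, |a z| ≤ 1) (hm : ∫ z, a z ∂P = 0)
    (s : ℝ) (hs : ∫ z, a z ^ 2 ∂P ≤ s) (n : ℕ) (hns : n * s ≤ 1 / 32)
    (F : (Fin n → Z) → ℝ) (hF : Measurable F) (hF0 : ∀ ω, 0 ≤ F ω) (hF1 : ∀ ω, F ω ≤ 1) :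
    1 / 2 ≤ (∫ ω, F ω ∂(Measure.pi fun _ : Fin n =>
          P.withDensity (fun z => ENNReal.ofReal (1 + a z)))) +
      ∫ ω, (1 - F ω) ∂(Measure.pi fun _ : Fin n =>
          P.withDensity (fun z => ENNReal.ofReal (1 - a z))) := by
  have hab : ∀ z, -1 ≤ a z ∧ a z ≤ 1 := fun z => abs_le.1 (ha1 z)
  rw [pi_withDensity_ofReal P (fun z => 1 + a z) (ha.const_add 1)
      (fun z => by linarith [(hab z).1]) (fun z => by linarith [(hab z).2]),
    pi_withDensity_ofReal P (fun z => 1 - a z) (ha.const_sub 1)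
      (fun z => by linarith [(hab z).2]) (fun z => by linarith [(hab z).1])]
  obtain ⟨I1, I2, I3⟩ := prod_sq_dev P a ha ha1 hm s hs n hns
  obtain ⟨J1, J2, J3⟩ := prod_sq_dev P (fun z => -a z) ha.neg (by simpa using ha1)
    (by rw [integral_neg, hm, neg_zero]) s (by simpa using hs) n hns
  simp only [← sub_eq_add_neg] at J1 J2 J3
  have hm1 : Measurable (fun ω : Fin n → Z => ∏ i, (1 + a (ω i))) := by fun_prop
  have hm2 : Measurable (fun ω : Fin n → Z => ∏ i, (1 - a (ω i))) := by fun_prop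
  have p1 : ∀ ω : Fin n → Z, 0 ≤ ∏ i, (1 + a (ω i)) := fun ω =>
    Finset.prod_nonneg fun i _ => by linarith [(hab (ω i)).1]
  have p2 : ∀ ω : Fin n → Z, 0 ≤ ∏ i, (1 - a (ω i)) := fun ω =>
    Finset.prod_nonneg fun i _ => by linarith [(hab (ω i)).2]
  rw [integral_withDensity_eq_integral_toReal_smul hm1.ennreal_ofReal
      (Filter.Eventually.of_forall fun _ => ENNReal.ofReal_lt_top),
    integral_withDensity_eq_integral_toReal_smul hm2.ennreal_ofReal
      (Filter.Eventually.of_forall fun _ => ENNReal.ofReal_lt_top)]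
  simp only [ENNReal.toReal_ofReal (p1 _), ENNReal.toReal_ofReal (p2 _), smul_eq_mul]
  have K1 : Integrable (fun ω : Fin n → Z => (∏ i, (1 + a (ω i))) * F ω)
      (Measure.pi fun _ => P) := I1.mul_bdd (c := 1) hF.aestronglyMeasurable
        (Filter.Eventually.of_forall fun ω => by
          rw [Real.norm_of_nonneg (hF0 ω)]; exact hF1 ω)
  have K2 : Integrable (fun ω : Fin n → Z => (∏ i, (1 - a (ω i))) * (1 - F ω))
      (Measure.pi fun _ => P) := J1.mul_bdd (c := 1) (hF.const_sub 1).aestronglyMeasurable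
        (Filter.Eventually.of_forall fun ω => by
          rw [Real.norm_of_nonneg (by linarith [hF1 ω])]; linarith [hF0 ω])
  rw [← integral_add K1 K2]
  have lb : ∫ ω : Fin n → Z, (3 / 4 - 2 * (∏ i, (1 + a (ω i)) - 1) ^ 2
      - 2 * (∏ i, (1 - a (ω i)) - 1) ^ 2) ∂(Measure.pi fun _ => P) ≤
      ∫ ω : Fin n → Z, ((∏ i, (1 + a (ω i))) * F ω + (∏ i, (1 - a (ω i))) * (1 - F ω))
        ∂(Measure.pi fun _ => P) := by
    apply integral_mono
    · exact ((integrable_const _).sub (I2.const_mul 2)).sub (J2.const_mul 2)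
    · exact K1.add K2
    · intro ω
      simp only
      have f0 := hF0 ω
      have f1 := hF1 ω
      generalize (∏ i, (1 + a (ω i))) = A
      generalize (∏ i, (1 - a (ω i))) = B
      generalize F ω = f at *
      nlinarith [mul_nonneg f0 (sq_nonneg (4 * (A - 1) + 1)),
        mul_nonneg (sub_nonneg.2 f1) (sq_nonneg (4 * (B - 1) + 1)),
        mul_nonneg f0 (sq_nonneg (B - 1)), mul_nonneg (sub_nonneg.2 f1) (sq_nonneg (A - 1))]
  refine le_trans ?_ lb
  have IS : Integrable (fun ω : Fin n → Z => 3 / 4 - 2 * (∏ i, (1 + a (ω i)) - 1) ^ 2)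
      (Measure.pi fun _ => P) := (integrable_const _).sub (I2.const_mul 2)
  rw [integral_sub IS (J2.const_mul 2),
    integral_sub (integrable_const _) (I2.const_mul 2), integral_const_mul, integral_const_mul]
  simp
  linarith

section joint
variable {d : ℕ} {PX : Measure (Euc d)}

lemma lintegral_jointLaw {η : Euc d → ℝ} (hη : Measurable η) {g : Euc d × Bool → ℝ≥0∞}
    (hg : Measurable g) :
    ∫⁻ z, g z ∂(jointLaw PX η) = ∫⁻ x, (ENNReal.ofReal (η x) * g (x, true) +
      ENNReal.ofReal (1 - η x) * g (x, false)) ∂PX := by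
  unfold jointLaw
  rw [Measure.lintegral_bind _ hg.aemeasurable]
  · apply lintegral_congr
    intro x
    rw [lintegral_add_measure, lintegral_smul_measure, lintegral_smul_measure,
      lintegral_dirac' _ hg, lintegral_dirac' _ hg]
    rfl
  · apply Measurable.aemeasurable
    apply Measure.measurable_of_measurable_coe
    intro s hs
    simp only [Measure.coe_add, Measure.coe_smul, Pi.add_apply, Pi.smul_apply, smul_eq_mul]
    simp only [Measure.dirac_apply' _ hs]
    have h1 : Measurable (s.indicator (1 : Euc d × Bool → ℝ≥0∞)) := measurable_one.indicator hs
    have h2 : ∀ b : Bool, Measurable fun x : Euc d => s.indicator (1 : Euc d × Bool → ℝ≥0∞) (x, b) :=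
      fun b => h1.comp (measurable_id.prodMk measurable_const)
    exact (hη.ennreal_ofReal.mul (h2 true)).add ((hη.const_sub 1).ennreal_ofReal.mul (h2 false))

lemma ofReal_add_compl {t : ℝ} (ht : t ∈ Icc (0:ℝ) 1) :
    ENNReal.ofReal t + ENNReal.ofReal (1 - t) = 1 := by
  rw [← ENNReal.ofReal_add ht.1 (by linarith [ht.2])]; simp

lemma jointLaw_prob [IsProbabilityMeasure PX] {η : Euc d → ℝ} (hη : Measurable η)
    (h01 : ∀ x, η x ∈ Icc (0:ℝ) 1) : IsProbabilityMeasure (jointLaw PX η) := by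
  constructor
  have := lintegral_jointLaw (PX := PX) hη (g := fun _ => 1) measurable_const
  simp only [lintegral_const, one_mul, mul_one, ofReal_add_compl (h01 _)] at this
  simpa using this

lemma jointLaw_withDensity {η η0 : Euc d → ℝ} (hη : Measurable η) (hη0 : Measurable η0)
    (h01 : ∀ x, η0 x ∈ Icc (0:ℝ) 1) {g : Euc d × Bool → ℝ} (hg : Measurable g)
    (h1 : ∀ x, η x = η0 x * g (x, true)) (h2 : ∀ x, 1 - η x = (1 - η0 x) * g (x, false)) :
    jointLaw PX η = (jointLaw PX η0).withDensity (fun z => ENNReal.ofReal (g z)) := by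
  ext s hs
  rw [withDensity_apply _ hs, ← lintegral_indicator hs, ← lintegral_indicator_one hs,
    lintegral_jointLaw hη (measurable_one.indicator hs),
    lintegral_jointLaw hη0 (hg.ennreal_ofReal.indicator hs)]
  apply lintegral_congr
  intro x
  rw [h1 x, ← h1 x, h2 x, h1 x, ENNReal.ofReal_mul (h01 x).1,
    ENNReal.ofReal_mul (by linarith [(h01 x).2])]
  have k : ∀ z, s.indicator (fun z => ENNReal.ofReal (g z)) z =
      ENNReal.ofReal (g z) * s.indicator (1 : Euc d × Bool → ℝ≥0∞) z := by
    intro z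
    by_cases hz : z ∈ s <;> simp [hz]
  rw [k, k, mul_assoc, mul_assoc]

lemma jointLaw_congr {η η' : Euc d → ℝ} (h : η =ᵐ[PX] η') : jointLaw PX η = jointLaw PX η' := by
  unfold jointLaw
  apply Measure.bind_congr_right
  filter_upwards [h] with x hx
  rw [hx]

lemma expExcessRule_congr {η η' : Euc d → ℝ} (h : η =ᵐ[PX] η') {n : ℕ}
    (fhat : Sample d n → Euc d → Bool) :
    expExcessRule PX η fhat = expExcessRule PX η' fhat := by
  unfold expExcessRule sampleLaw
  rw [jointLaw_congr h]
  have hr : ∀ f, risk PX η f = risk PX η' f := by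
    intro f
    unfold risk
    apply integral_congr_ae
    filter_upwards [h] with x hx
    rw [hx]
  have hb : risk PX η (bayes η) = risk PX η' (bayes η') := by
    unfold risk
    apply integral_congr_ae
    filter_upwards [h] with x hx
    have e : bayes η x = bayes η' x := by unfold bayes; rw [hx]
    rw [e, hx]
  rw [hb]
  simp only [hr]

/-- Pointwise excess loss. -/
def exc (t : ℝ) (b : Bool) : ℝ :=
  (if b then 1 - t else t) - (if decide ((1:ℝ)/2 ≤ t) then 1 - t else t)

lemma exc_nonneg (t : ℝ) (b : Bool) : 0 ≤ exc t b := by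
  unfold exc
  simp only [decide_eq_true_eq]
  split_ifs <;> linarith

lemma exc_le {t : ℝ} (ht : t ∈ Icc (0:ℝ) 1) (b : Bool) : exc t b ≤ 1 := by
  unfold exc
  simp only [decide_eq_true_eq]
  split_ifs <;> linarith [ht.1, ht.2]

lemma measurable_exc {Ω : Type*} [MeasurableSpace Ω] {t : Ω → ℝ} {b : Ω → Bool} (ht : Measurable t)
    (hb : Measurable b) : Measurable fun ω => exc (t ω) (b ω) := by
  unfold exc
  apply Measurable.sub
  · exact Measurable.ite (hb (measurableSet_singleton true)) (ht.const_sub 1) ht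
  · simp only [decide_eq_true_eq]
    exact Measurable.ite (measurableSet_le measurable_const ht) (ht.const_sub 1) ht

lemma expExcess_eq [IsProbabilityMeasure PX] {η : Euc d → ℝ} (hη : Measurable η)
    (h01 : ∀ x, η x ∈ Icc (0:ℝ) 1) {n : ℕ} {fhat : Sample d n → Euc d → Bool}
    (hf : Measurable (Function.uncurry fhat)) :
    Integrable (fun x => ∫ ω, exc (η x) (fhat ω x) ∂(sampleLaw PX η n)) PX ∧
    expExcessRule PX η fhat = ∫ x, ∫ ω, exc (η x) (fhat ω x) ∂(sampleLaw PX η n) ∂PX := by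
  have hP := jointLaw_prob (PX := PX) hη h01
  have hS : IsProbabilityMeasure (sampleLaw PX η n) := by unfold sampleLaw; infer_instance
  have hIntg : Integrable (Function.uncurry fun (ω : Sample d n) (x : Euc d) =>
      exc (η x) (fhat ω x)) ((sampleLaw PX η n).prod PX) := by
    apply Integrable.of_bound (C := 1)
    · exact (measurable_exc (hη.comp measurable_snd) hf).aestronglyMeasurable
    · refine Filter.Eventually.of_forall fun p => ?_
      show ‖exc (η p.2) (fhat p.1 p.2)‖ ≤ 1
      rw [Real.norm_of_nonneg (exc_nonneg _ _)]
      exact exc_le (h01 _) _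
  refine ⟨hIntg.integral_prod_right, ?_⟩
  have hloss : ∀ f : Euc d → Bool, Measurable f →
      Integrable (fun x => if f x then 1 - η x else η x) PX := by
    intro f hf
    apply Integrable.of_bound (C := 1)
    · exact (Measurable.ite (hf (measurableSet_singleton true))
        (hη.const_sub 1) hη).aestronglyMeasurable
    · refine Filter.Eventually.of_forall fun x => ?_
      have := h01 x
      rw [Real.norm_eq_abs, abs_le]
      split_ifs <;> constructor <;> linarith [this.1, this.2]
  have hbm : Measurable (bayes η) := by
    apply measurable_to_bool
    have : bayes η ⁻¹' {true} = {x | (1:ℝ)/2 ≤ η x} := by ext x; simp [bayes]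
    rw [this]
    exact measurableSet_le measurable_const hη
  have hfm : ∀ ω, Measurable (fhat ω) := fun ω => hf.comp measurable_prodMk_left
  have h1 : ∀ ω, ∫ x, exc (η x) (fhat ω x) ∂PX = risk PX η (fhat ω) - risk PX η (bayes η) := by
    intro ω
    unfold risk
    rw [← integral_sub (hloss _ (hfm ω)) (hloss _ hbm)]
    rfl
  rw [← integral_integral_swap hIntg]
  simp only [h1]
  have hI : Integrable (fun ω => risk PX η (fhat ω)) (sampleLaw PX η n) := by
    have h2 := hIntg.integral_prod_left
    simp only [Function.uncurry_apply_pair, h1] at h2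
    have h3 := h2.add (integrable_const (risk PX η (bayes η)))
    refine h3.congr (Filter.Eventually.of_forall fun ω => ?_)
    simp
  rw [integral_sub hI (integrable_const _)]
  simp [expExcessRule]

end joint

section core
variable {d : ℕ} {PX : Measure (Euc d)} {J : Type*} [Fintype J] [DecidableEq J]

/-- Piecewise constant regression function. -/
def etaS (B : J → Set (Euc d)) (δ : ℝ) (τ : J → ℝ) (x : Euc d) : ℝ :=
  1 / 2 + δ * ∑ j, (B j).indicator (fun _ => τ j) x

lemma etaS_mem {B : J → Set (Euc d)} (hB : Pairwise (Function.onFun Disjoint B)) (δ : ℝ)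
    (τ : J → ℝ) {x : Euc d} {j : J} (hx : x ∈ B j) : etaS B δ τ x = 1 / 2 + δ * τ j := by
  unfold etaS
  rw [Finset.sum_eq_single j]
  · rw [Set.indicator_of_mem hx]
  · intro i _ hi
    apply Set.indicator_of_notMem
    intro hxi
    exact Set.disjoint_left.1 (hB hi) hxi hx
  · simp

lemma etaS_notMem {B : J → Set (Euc d)} (δ : ℝ)
    (τ : J → ℝ) {x : Euc d} (hx : ∀ j, x ∉ B j) : etaS B δ τ x = 1 / 2 := by
  unfold etaS
  rw [Finset.sum_eq_zero]
  · simp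
  · intro i _
    exact Set.indicator_of_notMem (hx i) _

lemma etaS_measurable {B : J → Set (Euc d)} (hBm : ∀ j, MeasurableSet (B j)) (δ : ℝ)
    (τ : J → ℝ) : Measurable (etaS B δ τ) := by
  unfold etaS
  exact ((Finset.univ.measurable_fun_sum fun j _ =>
    measurable_const.indicator (hBm j)).const_mul δ).const_add _

lemma etaS_Icc {B : J → Set (Euc d)} (hB : Pairwise (Function.onFun Disjoint B)) {δ : ℝ}
    (hδ : 0 < δ) (hδ2 : δ ≤ 1 / 2)
    (τ : J → ℝ) (hτ : ∀ j, |τ j| ≤ 1) (x : Euc d) : etaS B δ τ x ∈ Icc (0:ℝ) 1 := by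
  by_cases h : ∃ j, x ∈ B j
  · obtain ⟨j, hj⟩ := h
    rw [etaS_mem hB δ τ hj]
    have := abs_le.1 (hτ j)
    constructor <;> nlinarith
  · push Not at h
    rw [etaS_notMem δ τ h]; norm_num

lemma two_point_joint [IsProbabilityMeasure PX] {B : J → Set (Euc d)}
    (hB : Pairwise (Function.onFun Disjoint B))
    (hBm : ∀ j, MeasurableSet (B j)) {δ w : ℝ} (hδ : 0 < δ) (hδ2 : δ ≤ 1 / 2) (n : ℕ)
    (hw : ∀ j, PX.real (B j) ≤ w) (hn : n * (4 * δ ^ 2 * w) ≤ 1 / 32)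
    (σ : J → Bool) (j : J) (F : Sample d n → ℝ) (hF : Measurable F) (hF0 : ∀ ω, 0 ≤ F ω)
    (hF1 : ∀ ω, F ω ≤ 1) :
    1 / 2 ≤ (∫ ω, F ω ∂(sampleLaw PX (etaS B δ (fun i => sg (Function.update σ j true i))) n)) +
      ∫ ω, (1 - F ω) ∂(sampleLaw PX (etaS B δ (fun i => sg (Function.update σ j false i))) n) := by
  set τ0 : J → ℝ := Function.update (fun i => sg (σ i)) j 0 with hτ0
  set η0 := etaS B δ τ0 with hη0
  have hτ0' : ∀ i, |τ0 i| ≤ 1 := by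
    intro i
    by_cases h : i = j
    · subst h; simp [hτ0]
    · simp [hτ0, h, abs_sg]
  have hm0 : Measurable η0 := etaS_measurable hBm δ τ0
  have h01 : ∀ x, η0 x ∈ Icc (0:ℝ) 1 := etaS_Icc hB hδ hδ2 τ0 hτ0'
  have hP := jointLaw_prob (PX := PX) hm0 h01
  set a : Euc d × Bool → ℝ := fun z => (B j).indicator (fun _ => 2 * δ) z.1 * sg z.2 with ha
  have ham : Measurable a := by
    apply Measurable.mul
    · exact (measurable_const.indicator (hBm j)).comp measurable_fst
    · exact (measurable_of_finite sg).comp measurable_snd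
  have hEtaHalf : ∀ x ∈ B j, η0 x = 1 / 2 := by
    intro x hx
    rw [hη0, etaS_mem hB δ τ0 hx]; simp [hτ0]
  have ha1 : ∀ z, |a z| ≤ 1 := by
    intro z
    rw [ha]; simp only
    rw [abs_mul, abs_sg, mul_one]
    by_cases h : z.1 ∈ B j
    · rw [Set.indicator_of_mem h, abs_of_pos (by linarith)]; linarith
    · rw [Set.indicator_of_notMem h]; simp
  have hoff : ∀ (b : Bool) x, x ∉ B j →
      etaS B δ (fun i => sg (Function.update σ j b i)) x = η0 x := by
    intro b x hx
    rw [hη0]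
    unfold etaS
    congr 2
    apply Finset.sum_congr rfl
    intro i _
    by_cases h : i = j
    · subst h; rw [Set.indicator_of_notMem hx, Set.indicator_of_notMem hx]
    · simp [hτ0, h]
  have hon : ∀ (b : Bool) x, x ∈ B j →
      etaS B δ (fun i => sg (Function.update σ j b i)) x = 1 / 2 + δ * sg b := by
    intro b x hx
    rw [etaS_mem hB _ _ hx]; simp
  have eP : jointLaw PX (etaS B δ (fun i => sg (Function.update σ j true i))) =
      (jointLaw PX η0).withDensity (fun z => ENNReal.ofReal (1 + a z)) := by
    apply jointLaw_withDensity (etaS_measurable hBm δ _) hm0 h01 (ham.const_add 1)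
    · intro x
      by_cases h : x ∈ B j
      · rw [hon _ x h, hEtaHalf x h]; simp [ha, h, sg]; ring
      · rw [hoff _ x h]; simp [ha, h]
    · intro x
      by_cases h : x ∈ B j
      · rw [hon _ x h, hEtaHalf x h]; simp [ha, h, sg]; ring
      · rw [hoff _ x h]; simp [ha, h]
  have eM : jointLaw PX (etaS B δ (fun i => sg (Function.update σ j false i))) =
      (jointLaw PX η0).withDensity (fun z => ENNReal.ofReal (1 - a z)) := by
    apply jointLaw_withDensity (etaS_measurable hBm δ _) hm0 h01 (ham.const_sub 1)
    · intro x
      by_cases h : x ∈ B j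
      · rw [hon _ x h, hEtaHalf x h]; simp [ha, h, sg]; ring
      · rw [hoff _ x h]; simp [ha, h]
    · intro x
      by_cases h : x ∈ B j
      · rw [hon _ x h, hEtaHalf x h]; simp [ha, h, sg]; ring
      · rw [hoff _ x h]; simp [ha, h]
  unfold sampleLaw
  rw [eP, eM]
  have hai : Integrable a (jointLaw PX η0) := Integrable.of_bound ham.aestronglyMeasurable 1
    (Filter.Eventually.of_forall fun z => ha1 z)
  refine two_point (jointLaw PX η0) a ham ha1 ?_ (4 * δ ^ 2 * w) ?_ n hn F hF hF0 hF1
  · rw [integral_eq_lintegral_pos_part_sub_lintegral_neg_part hai,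
      lintegral_jointLaw hm0 ham.ennreal_ofReal, lintegral_jointLaw hm0 (g := fun z => ENNReal.ofReal (-a z))
        ham.neg.ennreal_ofReal,
      sub_eq_zero]
    congr 1
    apply lintegral_congr
    intro x
    by_cases h : x ∈ B j
    · have e1 : a (x, true) = 2 * δ := by simp [ha, h, sg]
      have e2 : a (x, false) = -(2 * δ) := by simp [ha, h, sg]
      rw [hEtaHalf x h, e1, e2, neg_neg, show (1:ℝ) - 1 / 2 = 1 / 2 by norm_num]
      exact add_comm _ _
    · simp [ha, h]
  · rw [integral_eq_lintegral_of_nonneg_ae (Filter.Eventually.of_forall fun z => sq_nonneg _)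
      (ham.pow_const 2).aestronglyMeasurable,
      lintegral_jointLaw hm0 (ham.pow_const 2).ennreal_ofReal]
    have e : ∀ x, ENNReal.ofReal (η0 x) * ENNReal.ofReal (a (x, true) ^ 2) +
        ENNReal.ofReal (1 - η0 x) * ENNReal.ofReal (a (x, false) ^ 2) =
        (B j).indicator (fun _ => ENNReal.ofReal (4 * δ ^ 2)) x := by
      intro x
      by_cases h : x ∈ B j
      · have e1 : a (x, true) ^ 2 = 4 * δ ^ 2 := by simp [ha, h, sg]; ring
        have e2 : a (x, false) ^ 2 = 4 * δ ^ 2 := by simp [ha, h, sg]; ring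
        rw [e1, e2, ← add_mul, ofReal_add_compl (h01 x), one_mul, Set.indicator_of_mem h]
      · simp [ha, h]
    simp only [e]
    rw [lintegral_indicator (hBm j), setLIntegral_const, ENNReal.toReal_mul,
      ENNReal.toReal_ofReal (by positivity)]
    exact mul_le_mul_of_nonneg_left (hw j) (by positivity)

lemma exc_on {δ : ℝ} (hδ : 0 < δ) (s b : Bool) :
    exc (1 / 2 + δ * sg s) b = if b = s then 0 else 2 * δ := by
  unfold exc sg
  cases s <;> cases b <;> simp <;> (try norm_num) <;> (try split_ifs) <;> (try linarith)

lemma assouad [IsProbabilityMeasure PX] {B : J → Set (Euc d)}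
    (hB : Pairwise (Function.onFun Disjoint B))
    (hBm : ∀ j, MeasurableSet (B j)) {δ w : ℝ} (hδ : 0 < δ) (hδ2 : δ ≤ 1 / 2) (n : ℕ)
    (hw : ∀ j, PX.real (B j) ≤ w) (hn : n * (4 * δ ^ 2 * w) ≤ 1 / 32)
    (fhat : Sample d n → Euc d → Bool) (hf : Measurable (Function.uncurry fhat)) :
    ∃ σ : J → Bool, δ / 2 * PX.real (⋃ j, B j) ≤
      expExcessRule PX (etaS B δ (fun i => sg (σ i))) fhat := by
  set η : (J → Bool) → Euc d → ℝ := fun σ => etaS B δ (fun i => sg (σ i)) with hη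
  have hm : ∀ σ, Measurable (η σ) := fun σ => etaS_measurable hBm δ _
  have h01 : ∀ σ x, η σ x ∈ Icc (0:ℝ) 1 := fun σ =>
    etaS_Icc hB hδ hδ2 _ (fun j => (abs_sg _).le)
  have hP : ∀ σ, IsProbabilityMeasure (jointLaw PX (η σ)) := fun σ => jointLaw_prob (hm σ) (h01 σ)
  set H : (J → Bool) → Euc d → ℝ := fun σ x =>
    ∫ ω, exc (η σ x) (fhat ω x) ∂(sampleLaw PX (η σ) n) with hH
  have hHi : ∀ σ, Integrable (H σ) PX := fun σ => (expExcess_eq (hm σ) (h01 σ) hf).1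
  have hHe : ∀ σ, expExcessRule PX (η σ) fhat = ∫ x, H σ x ∂PX := fun σ =>
    (expExcess_eq (hm σ) (h01 σ) hf).2
  have hH0 : ∀ σ x, 0 ≤ H σ x := fun σ x => integral_nonneg fun ω => exc_nonneg _ _
  have hfx : ∀ x, Measurable fun ω => fhat ω x := fun x =>
    hf.comp (measurable_id.prodMk measurable_const)
  have hpair : ∀ j, ∀ x ∈ B j, ∀ σ : J → Bool,
      δ ≤ H (Function.update σ j true) x + H (Function.update σ j false) x := by
    intro j x hx σ
    set F : Sample d n → ℝ := fun ω => if fhat ω x = true then 0 else 1 with hF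
    have hFm : Measurable F := Measurable.ite (hfx x (measurableSet_singleton true))
      measurable_const measurable_const
    have := two_point_joint (PX := PX) hB hBm hδ hδ2 n hw hn σ j F hFm
      (fun ω => by simp only [hF]; split_ifs <;> norm_num)
      (fun ω => by simp only [hF]; split_ifs <;> norm_num)
    have e1 : H (Function.update σ j true) x = 2 * δ * ∫ ω, F ω ∂(sampleLaw PX (etaS B δ (fun i => sg (Function.update σ j true i))) n) := by
      simp only [hH, hη]
      rw [← integral_const_mul]
      congr 1
      ext ω
      rw [etaS_mem hB _ _ hx, exc_on hδ]
      simp [hF]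
    have e2 : H (Function.update σ j false) x = 2 * δ * ∫ ω, (1 - F ω) ∂(sampleLaw PX (etaS B δ (fun i => sg (Function.update σ j false i))) n) := by
      simp only [hH, hη]
      rw [← integral_const_mul]
      congr 1
      ext ω
      rw [etaS_mem hB _ _ hx, exc_on hδ]
      simp only [hF]
      cases fhat ω x <;> simp
    rw [e1, e2]
    nlinarith
  have hsum : ∀ x, (⋃ j, B j).indicator (fun _ => (Fintype.card (J → Bool) : ℝ) * (δ / 2)) x ≤
      ∑ σ, H σ x := by
    intro x
    by_cases hx : x ∈ ⋃ j, B j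
    · rw [Set.indicator_of_mem hx]
      obtain ⟨j, hj⟩ := Set.mem_iUnion.1 hx
      let fl : (J → Bool) → (J → Bool) := fun σ => Function.update σ j (!σ j)
      have hfl : Function.Involutive fl := by
        intro σ
        simp [fl]
      have e1 : ∑ σ, H (fl σ) x = ∑ σ, H σ x :=
        Equiv.sum_comp (hfl.toPerm) (fun σ => H σ x)
      have e2 : ∀ σ : J → Bool, δ ≤ H σ x + H (fl σ) x := by
        intro σ
        have h := hpair j x hj σ
        cases hs : σ j
        · have : Function.update σ j false = σ := by rw [← hs]; simp
          rw [this] at h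
          simp only [fl, hs, Bool.not_false]; linarith
        · have : Function.update σ j true = σ := by rw [← hs]; simp
          rw [this] at h
          simp only [fl, hs, Bool.not_true]; linarith
      have e3 : ∑ σ : J → Bool, δ ≤ ∑ σ, (H σ x + H (fl σ) x) :=
        Finset.sum_le_sum fun σ _ => e2 σ
      rw [Finset.sum_add_distrib, e1, Finset.sum_const, nsmul_eq_mul, Finset.card_univ] at e3
      linarith
    · rw [Set.indicator_of_notMem hx]
      exact Finset.sum_nonneg fun σ _ => hH0 σ x
  have hU : MeasurableSet (⋃ j, B j) := MeasurableSet.iUnion hBm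
  have htot : ∑ σ : J → Bool, δ / 2 * PX.real (⋃ j, B j) ≤
      ∑ σ, expExcessRule PX (η σ) fhat := by
    simp only [hHe]
    rw [← integral_finsetSum _ (fun σ _ => hHi σ)]
    calc _ = ∫ x, (⋃ j, B j).indicator
          (fun _ => (Fintype.card (J → Bool) : ℝ) * (δ / 2)) x ∂PX := by
          rw [integral_indicator hU, setIntegral_const]
          simp; ring
      _ ≤ _ := integral_mono ((integrable_const _).indicator hU)
          (integrable_finsetSum _ fun σ _ => hHi σ) hsum
  obtain ⟨σ, _, h⟩ := Finset.exists_le_of_sum_le Finset.univ_nonempty htot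
  exact ⟨σ, h⟩

end core

lemma regular_ball {d : ℕ} {R : ℝ} (hR : 0 < R) :
    Regular ((1 / 2) ^ d) R (closedBall (0 : Euc d) R) := by
  intro x hx r hr hrR
  rw [mem_closedBall_zero_iff] at hx
  have hd : Module.finrank ℝ (Euc d) = d := by simp
  set y : Euc d := (1 - r / (2 * R)) • x with hy
  have ht : r / (2 * R) ≤ 1 / 2 := by
    rw [div_le_div_iff₀ (by positivity) (by norm_num)]; linarith
  have ht0 : 0 < r / (2 * R) := by positivity
  have htR : r / (2 * R) * R = r / 2 := by field_simp
  have hyn : ‖y‖ ≤ R - r / 2 := by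
    rw [hy, norm_smul, Real.norm_of_nonneg (by linarith)]
    nlinarith [norm_nonneg x]
  have hyx : dist y x ≤ r / 2 := by
    have e : y - x = (-(r / (2 * R))) • x := by rw [hy]; module
    rw [dist_eq_norm, e, norm_smul, norm_neg, Real.norm_of_nonneg ht0.le]
    nlinarith [norm_nonneg x]
  have hsub : closedBall y (r / 2) ⊆ closedBall (0 : Euc d) R ∩ closedBall x r := by
    apply subset_inter
    · apply closedBall_subset_closedBall'
      rw [dist_zero_right]; linarith
    · apply closedBall_subset_closedBall'
      linarith
  refine le_trans ?_ (measure_mono hsub)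
  rw [Measure.addHaar_closedBall' volume x hr.le,
    Measure.addHaar_closedBall' volume y (by positivity : 0 ≤ r / 2),
    hd, ← mul_assoc, ← ENNReal.ofReal_mul (by positivity), ← mul_pow]
  apply le_of_eq
  congr 3
  ring

section marg
variable {d : ℕ} {ι : Type*} [Fintype ι]

/-- Piecewise constant density. -/
def dens (S : ι → Set (Euc d)) (h : ι → ℝ) (x : Euc d) : ℝ := ∑ i, (S i).indicator (fun _ => h i) x

lemma dens_mem {S : ι → Set (Euc d)} (hS : Pairwise (Function.onFun Disjoint S)) (h : ι → ℝ)
    {x : Euc d} {i : ι} (hx : x ∈ S i) : dens S h x = h i := by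
  unfold dens
  rw [Finset.sum_eq_single i]
  · rw [Set.indicator_of_mem hx]
  · intro j _ hj
    apply Set.indicator_of_notMem
    intro hxi
    exact Set.disjoint_left.1 (hS hj) hxi hx
  · simp

lemma dens_notMem {S : ι → Set (Euc d)} (h : ι → ℝ)
    {x : Euc d} (hx : ∀ i, x ∉ S i) : dens S h x = 0 := by
  unfold dens
  exact Finset.sum_eq_zero fun i _ => Set.indicator_of_notMem (hx i) _

lemma dens_measurable {S : ι → Set (Euc d)} (hSm : ∀ i, MeasurableSet (S i)) (h : ι → ℝ) :
    Measurable (dens S h) := by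
  unfold dens
  exact Finset.univ.measurable_fun_sum fun j _ => measurable_const.indicator (hSm j)

/-- Measure with piecewise constant density. -/
def marg (S : ι → Set (Euc d)) (h : ι → ℝ) : Measure (Euc d) :=
  volume.withDensity fun x => ENNReal.ofReal (dens S h x)

lemma marg_apply {S : ι → Set (Euc d)} (hS : Pairwise (Function.onFun Disjoint S))
    (hSm : ∀ i, MeasurableSet (S i)) (h : ι → ℝ) (i : ι) :
    marg S h (S i) = ENNReal.ofReal (h i) * volume (S i) := by
  unfold marg
  rw [withDensity_apply _ (hSm i), ← setLIntegral_const]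
  apply setLIntegral_congr_fun (hSm i)
  intro x hx
  simp only
  rw [dens_mem hS h hx]

lemma marg_ae {S : ι → Set (Euc d)} (hSm : ∀ i, MeasurableSet (S i)) (h : ι → ℝ) :
    ∀ᵐ x ∂(marg S h), ∃ i, x ∈ S i := by
  unfold marg
  rw [ae_withDensity_iff (dens_measurable hSm h).ennreal_ofReal]
  refine Filter.Eventually.of_forall fun x hx => ?_
  by_contra hc
  push Not at hc
  exact hx (by rw [dens_notMem h hc]; simp)

lemma marg_prob {S : ι → Set (Euc d)} (hS : Pairwise (Function.onFun Disjoint S))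
    (hSm : ∀ i, MeasurableSet (S i)) (p v : ι → ℝ) (hp : ∀ i, 0 ≤ p i) (hv : ∀ i, 0 < v i)
    (hvol : ∀ i, volume (S i) = ENNReal.ofReal (v i)) (hsum : ∑ i, p i = 1) :
    IsProbabilityMeasure (marg S fun i => p i / v i) ∧
      ∀ i, marg S (fun i => p i / v i) (S i) = ENNReal.ofReal (p i) := by
  have h1 : ∀ i, marg S (fun i => p i / v i) (S i) = ENNReal.ofReal (p i) := by
    intro i
    rw [marg_apply hS hSm, hvol, ← ENNReal.ofReal_mul (div_nonneg (hp i) (hv i).le),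
      div_mul_cancel₀ _ (hv i).ne']
  refine ⟨⟨?_⟩, h1⟩
  have h2 : marg S (fun i => p i / v i) univ = marg S (fun i => p i / v i) (⋃ i, S i) := by
    apply measure_congr
    filter_upwards [marg_ae hSm (fun i => p i / v i)] with x hx
    obtain ⟨i, hi⟩ := hx
    apply propext
    exact ⟨fun _ => Set.mem_iUnion.2 ⟨i, hi⟩, fun _ => trivial⟩
  rw [h2, measure_iUnion hS hSm, tsum_fintype]
  simp only [h1]
  rw [← ENNReal.ofReal_sum_of_nonneg fun i _ => hp i, hsum, ENNReal.ofReal_one]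

end marg

set_option maxHeartbeats 1000000 in
lemma construct {d : ℕ} (hd : 1 ≤ d) {α β L c M : ℝ} (hα : 0 < α) (hβ : 0 < β)
    {φ : Euc d → ℝ} (hφ : ContDiff ℝ ((⌈β⌉₊ - 1 + 1 : ℕ)) φ)
    (hφ1 : ∀ x, ‖x‖ ≤ 1 / 4 → φ x = 1) (hφa : ∀ x, |φ x| ≤ 1)
    (hφM : ∀ k ≤ ⌈β⌉₊ - 1 + 1, ∀ x, ‖iteratedFDeriv ℝ k φ x‖ ≤ M)
    (hφ0 : ∀ k ≤ ⌈β⌉₊ - 1 + 1, ∀ x, 1 / 3 < ‖x‖ → iteratedFDeriv ℝ k φ x = 0) (hM : 0 < M)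
    (hc : 0 < c) (hc2 : c ≤ 1 / 16) (hcL : c * (((⌈β⌉₊:ℝ)+1)*M) ≤ L)
    {q : ℕ} (hq : 1 ≤ q) {n : ℕ} (hqn : (n : ℝ) ≤ (q : ℝ) ^ ((2 + α) * β + d))
    (fhat : Sample d n → Euc d → Bool) (hf : Measurable (Function.uncurry fhat)) :
    ∃ (PX : Measure (Euc d)) (η : Euc d → ℝ),
          (IsProbabilityMeasure PX ∧ Measurable η ∧ (∀ x, η x ∈ Icc (0 : ℝ) 1) ∧
            Margin PX η α (c ^ (-α)) ∧ HolderClass β L η ∧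
            MildDensity PX ((1 / 2) ^ d) (d + 4)
              (4 ^ d / (volume (closedBall (0 : Euc d) 1)).toReal) (closedBall 0 (d + 4))) ∧
          c / 2 * (q : ℝ) ^ (-((1 + α) * β)) ≤ expExcessRule PX η fhat := by
  have hfr : Module.finrank ℝ (Euc d) = d := by simp
  have hq1 : (1:ℝ) ≤ q := by exact_mod_cast hq
  have hq0 : (0:ℝ) < q := by linarith
  have : Nonempty (Fin d) := ⟨⟨0, hd⟩⟩
  have : Nontrivial (Euc d) := inferInstance
  set v1 := (volume (closedBall (0 : Euc d) 1)).toReal with hv1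
  have hv1' : volume (closedBall (0 : Euc d) 1) = ENNReal.ofReal v1 :=
    (ENNReal.ofReal_toReal measure_closedBall_lt_top.ne).symm
  have hv1p : 0 < v1 := ENNReal.toReal_pos
    (measure_closedBall_pos _ _ one_pos).ne' measure_closedBall_lt_top.ne
  obtain ⟨z0, hz0⟩ := exists_norm_eq (Euc d) (c := (d : ℝ) + 3) (by positivity)
  set B : (Fin d → Fin q) → Set (Euc d) := fun j =>
    closedBall ((1 / (q:ℝ)) • grid j) (1 / (4 * q)) with hB
  have hmemB : ∀ x j, x ∈ B j ↔ dist ((q:ℝ) • x) (grid j) ≤ 1 / 4 := by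
    intro x j
    have e : grid j = (q:ℝ) • ((1 / (q:ℝ)) • grid j) := by
      rw [smul_smul, mul_one_div_cancel hq0.ne', one_smul]
    rw [e, dist_smul₀, Real.norm_of_nonneg hq0.le, hB]
    simp only [mem_closedBall]
    rw [le_div_iff₀ (by positivity)]
    constructor <;> intro h <;> linarith
  have hBd : Pairwise (Function.onFun Disjoint B) := by
    intro i j hij
    apply Set.disjoint_left.2
    intro x hx hx'
    rw [hmemB] at hx hx'
    exact hij (grid_unique (x := (q:ℝ) • x) (by linarith) (by linarith))
  have hBm : ∀ j, MeasurableSet (B j) := fun j => measurableSet_closedBall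
  have hnear : ∀ (x : Euc d) (j : Fin d → Fin q), dist ((q:ℝ) • x) (grid j) ≤ 1 / 3 →
      ‖x‖ ≤ d + 1 := by
    intro x j h
    have h1 : ‖(q:ℝ) • x‖ ≤ dist ((q:ℝ) • x) (grid j) + ‖grid j‖ := by
      rw [dist_eq_norm]
      simpa using norm_add_le ((q:ℝ) • x - grid j) (grid j)
    have h2 := grid_norm j
    rw [norm_smul, Real.norm_of_nonneg hq0.le] at h1
    have h3 : (q:ℝ) * ‖x‖ ≤ q * (d + 1) := by nlinarith
    exact le_of_mul_le_mul_left h3 hq0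
  have hA0 : ∀ x ∈ closedBall z0 1, (d:ℝ) + 2 ≤ ‖x‖ := by
    intro x hx
    rw [mem_closedBall, dist_eq_norm] at hx
    have := norm_sub_norm_le z0 x
    rw [norm_sub_rev] at this
    linarith
  have hA0' : ∀ x ∈ closedBall z0 1, ‖x‖ ≤ (d:ℝ) + 4 := by
    intro x hx
    rw [mem_closedBall, dist_eq_norm] at hx
    have := norm_sub_norm_le x z0
    linarith
  -- the marginal distribution
  set w : ℝ := (q:ℝ) ^ (-(α * β) - d) with hw
  have hw0 : 0 < w := Real.rpow_pos_of_pos hq0 _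
  have hmw : (q:ℝ) ^ d * w = (q:ℝ) ^ (-(α * β)) := by
    rw [hw, ← Real.rpow_natCast, ← Real.rpow_add hq0]; congr 1; ring
  have hmw1 : (q:ℝ) ^ (-(α * β)) ≤ 1 :=
    Real.rpow_le_one_of_one_le_of_nonpos hq1 (by nlinarith)
  let S : Option (Fin d → Fin q) → Set (Euc d) := fun o => o.elim (closedBall z0 1) B
  let p : Option (Fin d → Fin q) → ℝ := fun o => o.elim (1 - (q:ℝ) ^ (-(α * β))) (fun _ => w)
  let v : Option (Fin d → Fin q) → ℝ := fun o => o.elim v1 (fun _ => (1 / (4 * q)) ^ d * v1)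
  have hSm : ∀ i, MeasurableSet (S i) := by
    rintro (_ | j)
    · exact measurableSet_closedBall
    · exact hBm j
  have hdis : ∀ j, Disjoint (closedBall z0 1) (B j) := by
    intro j
    apply Set.disjoint_left.2
    intro x hx hx'
    rw [hmemB] at hx'
    have h1 := hA0 x hx
    have h2 := hnear x j (by linarith)
    linarith
  have hSd : Pairwise (Function.onFun Disjoint S) := by
    rintro (_ | i) (_ | j) hij
    · exact absurd rfl hij
    · exact hdis j
    · exact (hdis i).symm
    · exact hBd (fun h => hij (by rw [h]))
  have hp : ∀ i, 0 ≤ p i := by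
    rintro (_ | j)
    · show 0 ≤ 1 - (q:ℝ) ^ (-(α * β))
      linarith
    · exact hw0.le
  have hv : ∀ i, 0 < v i := by
    rintro (_ | j)
    · exact hv1p
    · show 0 < (1 / (4 * (q:ℝ))) ^ d * v1
      positivity
  have hvol : ∀ i, volume (S i) = ENNReal.ofReal (v i) := by
    rintro (_ | j)
    · show volume (closedBall z0 1) = ENNReal.ofReal v1
      rw [← hv1']
      rw [Measure.addHaar_closedBall' _ z0 (by norm_num)]; simp
    · show volume (closedBall ((1 / (q:ℝ)) • grid j) (1 / (4 * q))) =
        ENNReal.ofReal ((1 / (4 * q)) ^ d * v1)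
      rw [Measure.addHaar_closedBall' _ _ (by positivity), hv1', hfr,
        ENNReal.ofReal_mul (by positivity)]
  have hsum : ∑ i, p i = 1 := by
    rw [Fintype.sum_option]
    show 1 - (q:ℝ) ^ (-(α * β)) + ∑ j : Fin d → Fin q, w = 1
    rw [Finset.sum_const, Finset.card_univ, nsmul_eq_mul, Fintype.card_pi]
    simp [hmw]
  obtain ⟨hprob, hPS⟩ := marg_prob hSd hSm p v hp hv hvol hsum
  set h : Option (Fin d → Fin q) → ℝ := fun i => p i / v i with hh
  set PX := marg S h with hPX
  have hPB : ∀ j, PX.real (B j) = w := by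
    intro j
    have := hPS (some j)
    unfold Measure.real
    rw [show B j = S (some j) from rfl, this]
    exact ENNReal.toReal_ofReal hw0.le
  have hPU : PX.real (⋃ j, B j) = (q:ℝ) ^ (-(α * β)) := by
    unfold Measure.real
    rw [measure_iUnion hBd hBm, tsum_fintype]
    have e : ∀ j, PX (B j) = ENNReal.ofReal w := fun j => hPS (some j)
    simp only [e]
    rw [← ENNReal.ofReal_sum_of_nonneg fun i _ => hw0.le,
      ENNReal.toReal_ofReal (Finset.sum_nonneg fun i _ => hw0.le), Finset.sum_const,
      Finset.card_univ, nsmul_eq_mul, Fintype.card_pi]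
    simp [hmw]
  have hae : ∀ᵐ x ∂PX, x ∈ closedBall z0 1 ∨ ∃ j, x ∈ B j := by
    filter_upwards [marg_ae hSm h] with x hx
    obtain ⟨(_ | j), hi⟩ := hx
    · exact Or.inl hi
    · exact Or.inr ⟨j, hi⟩
  -- the lower bound
  set δ : ℝ := c * (q:ℝ) ^ (-β) with hδ
  have hqβ : 0 < (q:ℝ) ^ (-β) := Real.rpow_pos_of_pos hq0 _
  have hqβ1 : (q:ℝ) ^ (-β) ≤ 1 := Real.rpow_le_one_of_one_le_of_nonpos hq1 (by linarith)
  have hδ0 : 0 < δ := by positivity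
  have hδc : δ ≤ c := by rw [hδ]; nlinarith
  have hδ2 : δ ≤ 1 / 2 := by linarith
  have hδw : δ ^ 2 * w = c ^ 2 * ((q:ℝ) ^ ((2 + α) * β + d))⁻¹ := by
    rw [hδ, hw, mul_pow, ← Real.rpow_natCast ((q:ℝ) ^ (-β)), ← Real.rpow_mul hq0.le, mul_assoc,
      ← Real.rpow_add hq0, ← Real.rpow_neg hq0.le]
    congr 2
    push_cast; ring
  have hn : (n:ℝ) * (4 * δ ^ 2 * w) ≤ 1 / 32 := by
    have hQ : 0 < (q:ℝ) ^ ((2 + α) * β + d) := Real.rpow_pos_of_pos hq0 _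
    have e : (n:ℝ) * (4 * δ ^ 2 * w) = 4 * c ^ 2 * (n * ((q:ℝ) ^ ((2 + α) * β + d))⁻¹) := by
      rw [mul_assoc 4, hδw]; ring
    have h1 : (n:ℝ) * ((q:ℝ) ^ ((2 + α) * β + d))⁻¹ ≤ 1 := by
      rw [← div_eq_mul_inv]; exact (div_le_one hQ).2 hqn
    rw [e]
    nlinarith [sq_nonneg c]
  obtain ⟨σ, hσ⟩ := assouad (PX := PX) hBd hBm hδ0 hδ2 n (fun j => (hPB j).le) hn fhat hf
  have hφz : ∀ x, 1 / 3 < ‖x‖ → φ x = 0 := phi_zero hφ0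
  set η : Euc d → ℝ := fun x => 1 / 2 + c * (q:ℝ) ^ (-β) * bumpSum φ σ ((q:ℝ) • x) with hη
  have hηB : ∀ j, ∀ x ∈ B j, η x = 1 / 2 + δ * sg (σ j) := by
    intro j x hx
    rw [hmemB] at hx
    simp only [hη]
    rw [bumpSum_near hφz σ _ j (by linarith), hφ1 _ (by rw [← dist_eq_norm]; exact hx), mul_one]
  have hηA : ∀ x ∈ closedBall z0 1, η x = 1 / 2 := by
    intro x hx
    simp only [hη]
    rw [bumpSum_far hφz σ, mul_zero, add_zero]
    intro j
    by_contra hcon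
    have h1 := hnear x j (not_lt.1 hcon)
    have h2 := hA0 x hx
    linarith
  have hηS : η =ᵐ[PX] etaS B δ (fun i => sg (σ i)) := by
    filter_upwards [hae] with x hx
    rcases hx with hx | ⟨j, hx⟩
    · rw [hηA x hx, etaS_notMem]
      intro j hj
      exact Set.disjoint_left.1 (hdis j) hx hj
    · rw [hηB j x hx, etaS_mem hBd _ _ hx]
  have hbc := bumpSum_contDiff (q := q) hφ σ
  refine ⟨PX, η, ⟨hprob, ?_, ?_, ?_, ?_, ?_⟩, ?_⟩
  · apply Measurable.const_add
    apply Measurable.const_mul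
    exact hbc.continuous.measurable.comp (measurable_const_smul (q:ℝ))
  · intro x
    have := abs_le.1 (bumpSum_abs hφz hφa σ ((q:ℝ) • x))
    simp only [hη]
    rw [← hδ]
    constructor <;> nlinarith
  · intro t ht
    by_cases htδ : t < δ
    · have : PX {x | 0 < |η x - 1 / 2| ∧ |η x - 1 / 2| ≤ t} = 0 := by
        apply measure_mono_null (t := {x | ¬ (x ∈ closedBall z0 1 ∨ ∃ j, x ∈ B j)}) _ hae
        rintro x ⟨h1, h2⟩ (hx | ⟨j, hx⟩)
        · rw [hηA x hx] at h1; simp at h1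
        · rw [hηB j x hx, add_sub_cancel_left, abs_mul, abs_sg, mul_one, abs_of_pos hδ0] at h2
          linarith
      rw [this]; simp
    · have h1 : PX {x | 0 < |η x - 1 / 2| ∧ |η x - 1 / 2| ≤ t} ≤ PX (⋃ j, B j) := by
        apply measure_mono_ae
        filter_upwards [hae] with x hx hx'
        rcases hx with hx | ⟨j, hx⟩
        · have := hx'.1
          rw [hηA x hx] at this; simp at this
        · exact Set.mem_iUnion.2 ⟨j, hx⟩
      refine h1.trans ?_
      rw [← ENNReal.ofReal_toReal (measure_ne_top PX (⋃ j, B j))]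
      apply ENNReal.ofReal_le_ofReal
      have e : (PX (⋃ j, B j)).toReal = (q:ℝ) ^ (-(α * β)) := hPU
      rw [e]
      have e2 : (q:ℝ) ^ (-(α * β)) = c ^ (-α) * δ ^ α := by
        rw [hδ, Real.mul_rpow hc.le hqβ.le, ← mul_assoc, ← Real.rpow_add hc,
          ← Real.rpow_mul hq0.le]
        simp; ring_nf
      rw [e2]
      have := Real.rpow_le_rpow hδ0.le (not_lt.1 htδ) hα.le
      exact mul_le_mul_of_nonneg_left this (Real.rpow_nonneg hc.le _)
  · exact holder_scaled (M := M) hβ (bumpSum φ σ) (by exact_mod_cast hbc)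
      (fun k hk x => bumpSum_deriv hφ hM hφM hφ0 σ k hk x) c q hq0 hc.le hcL
  · have hh0 : ∀ i, 0 ≤ h i := fun i => div_nonneg (hp i) (hv i).le
    have h4 : (1:ℝ) ≤ 4 ^ d := one_le_pow₀ (by norm_num)
    have hmax0 : 0 ≤ 4 ^ d / v1 := by positivity
    have hhm : ∀ i, h i ≤ 4 ^ d / v1 := by
      rintro (_ | j)
      · show (1 - (q:ℝ) ^ (-(α * β))) / v1 ≤ 4 ^ d / v1
        have : 0 < (q:ℝ) ^ (-(α * β)) := Real.rpow_pos_of_pos hq0 _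
        gcongr
        linarith
      · show w / ((1 / (4 * q)) ^ d * v1) ≤ 4 ^ d / v1
        have e : w / ((1 / (4 * (q:ℝ))) ^ d * v1) = 4 ^ d * (q ^ d * w) / v1 := by
          rw [one_div, inv_pow, mul_pow]
          field_simp
        rw [e, hmw]
        gcongr
        exact mul_le_of_le_one_right (by positivity) hmw1
    have hsupp : ∀ i, S i ⊆ closedBall (0 : Euc d) (d + 4) := by
      rintro (_ | j) x hx
      · rw [mem_closedBall_zero_iff]; exact hA0' x hx
      · rw [mem_closedBall_zero_iff]
        have := hnear x j (by have := (hmemB x j).1 hx; linarith)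
        linarith
    refine ⟨closedBall 0 (d + 4), isCompact_closedBall _ _, Subset.rfl,
      regular_ball (by positivity), dens S h, dens_measurable hSm h, ?_, ?_, rfl⟩
    · intro x _
      by_cases hx : ∃ i, x ∈ S i
      · obtain ⟨i, hi⟩ := hx
        rw [dens_mem hSd h hi]; exact ⟨hh0 i, hhm i⟩
      · push Not at hx
        rw [dens_notMem h hx]; exact ⟨le_rfl, hmax0⟩
    · intro x hx
      apply dens_notMem
      intro i hi
      exact hx (hsupp i hi)
  · rw [expExcessRule_congr hηS]
    refine le_trans (le_of_eq ?_) hσ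
    rw [hPU, hδ]
    have : (q:ℝ) ^ (-((1 + α) * β)) = (q:ℝ) ^ (-β) * (q:ℝ) ^ (-(α * β)) := by
      rw [← Real.rpow_add hq0]; congr 1; ring
    rw [this]; ring


/-- Theorem 4.1, minimax lower bound under the mild density
assumption. For suitable parameters, no classifier can beat the rate
`n^{-(1+α)β/((2+α)β+d)}` uniformly over the class `P_Σ'` (margin assumption, Hölder
regression function, mild density assumption). -/
theorem stmt10 (d : ℕ) (hd : 1 ≤ d) (α β L : ℝ) (hα : 0 < α) (hβ : 0 < β) (hL : 0 < L) :
    ∃ (C0 c0 r0 μmax : ℝ) (K : Set (Euc d)) (C : ℝ),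
      0 < C0 ∧ 0 < c0 ∧ 0 < r0 ∧ 0 < μmax ∧ IsCompact K ∧ 0 < C ∧
      ∀ (n : ℕ), 1 ≤ n → ∀ fhat : Sample d n → Euc d → Bool,
        Measurable (Function.uncurry fhat) →
        ∃ (PX : Measure (Euc d)) (η : Euc d → ℝ),
          (IsProbabilityMeasure PX ∧ Measurable η ∧ (∀ x, η x ∈ Icc (0 : ℝ) 1) ∧
            Margin PX η α C0 ∧ HolderClass β L η ∧ MildDensity PX c0 r0 μmax K) ∧
          C * (n : ℝ) ^ (-((1 + α) * β) / ((2 + α) * β + d)) ≤ expExcessRule PX η fhat := by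
  obtain ⟨φ, M, hφ, hφ1, hφa, hφM, hφ0, hM⟩ := exists_bump d (⌈β⌉₊ - 1 + 1)
  set c : ℝ := min (1 / 16) (L / (((⌈β⌉₊:ℝ) + 1) * M)) with hc
  have hQ : 0 < ((⌈β⌉₊:ℝ) + 1) * M := by positivity
  have hc0 : 0 < c := lt_min (by norm_num) (by positivity)
  have hc2 : c ≤ 1 / 16 := min_le_left _ _
  have hcL : c * (((⌈β⌉₊:ℝ) + 1) * M) ≤ L := (le_div_iff₀ hQ).1 (min_le_right _ _)
  have hv1p : 0 < (volume (closedBall (0 : Euc d) 1)).toReal := ENNReal.toReal_pos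
    (measure_closedBall_pos _ _ one_pos).ne' measure_closedBall_lt_top.ne
  have h2p : (0:ℝ) < 2 ^ (-((1 + α) * β)) := Real.rpow_pos_of_pos (by norm_num) _
  refine ⟨c ^ (-α), (1 / 2) ^ d, d + 4, 4 ^ d / (volume (closedBall (0 : Euc d) 1)).toReal,
    closedBall 0 (d + 4), c / 2 * 2 ^ (-((1 + α) * β)), Real.rpow_pos_of_pos hc0 _, by positivity,
    by positivity, by positivity, isCompact_closedBall _ _, by positivity, ?_⟩
  intro n hn fhat hf
  set D : ℝ := (2 + α) * β + d with hD
  have hD0 : 0 < D := by positivity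
  have hn1 : (1:ℝ) ≤ n := by exact_mod_cast hn
  have hn0 : (0:ℝ) < n := by linarith
  set s : ℝ := (n:ℝ) ^ (1 / D) with hs
  have hs1 : 1 ≤ s := Real.one_le_rpow hn1 (by positivity)
  have hq : 1 ≤ ⌈s⌉₊ := Nat.one_le_ceil_iff.2 (by linarith)
  have hsq : s ≤ (⌈s⌉₊ : ℝ) := Nat.le_ceil s
  have hqs : (⌈s⌉₊ : ℝ) ≤ 2 * s := by
    have := (Nat.ceil_lt_add_one (by linarith : 0 ≤ s)).le
    linarith
  have hqn : (n:ℝ) ≤ (⌈s⌉₊ : ℝ) ^ D := by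
    have h1 : s ^ D = n := by
      rw [hs, ← Real.rpow_mul hn0.le, one_div_mul_cancel hD0.ne', Real.rpow_one]
    rw [← h1]
    exact Real.rpow_le_rpow (by linarith) hsq hD0.le
  obtain ⟨PX, η, h1, h2⟩ := construct hd hα hβ hφ hφ1 hφa hφM hφ0 hM hc0 hc2 hcL hq hqn fhat hf
  refine ⟨PX, η, h1, le_trans ?_ h2⟩
  rw [mul_assoc]
  apply mul_le_mul_of_nonneg_left _ (by positivity)
  have e : (n:ℝ) ^ (-((1 + α) * β) / D) = s ^ (-((1 + α) * β)) := by
    rw [hs, ← Real.rpow_mul hn0.le]; congr 1; ring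
  rw [e, ← Real.mul_rpow (by norm_num) (by linarith)]
  exact Real.rpow_le_rpow_of_nonpos (by linarith) hqs (by
    have : 0 < (1 + α) * β := by positivity
    linarith)

end
end

section
/- Let d ≥ 1 be an integer, let α ≥ 0, C0, β, L > 0 and let C ⊂ R^d be compact. Let P_Σ^0 be the class of all distributions P of (X,Y) on R^d × {0,1} satisfying the margin assumption MA(α, C0), with regression function η in the Hölder class Σ(β, L, R^d), and with the support of P_X included in C. Then there exists a constant C' > 0 depending only on α, β, d, L and C0 and, for each n ≥ 1, a classifier f̂_n^S (a measurable function of the sample with values in decision rules) such that sup_{P ∈ P_Σ^0} { E[R(f̂_n^S)] − R(f*) } ≤ C' n^{−(1+α)β/((2+α)β+d)}. -/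
open MeasureTheory Metric Set
open scoped ENNReal NNReal

noncomputable section

def cube {d : ℕ} (c : Euc d) (r : ℝ) : Set (Euc d) := {x | ∀ i, |x i - c i| ≤ r}
lemma norm_le_of_mem_cube {d : ℕ} (hd : 1 ≤ d) {c x : Euc d} {r : ℝ} (hr : 0 ≤ r)
    (hx : x ∈ cube c r) : ‖x - c‖ ≤ d * r := by
  have hd' : (1 : ℝ) ≤ d := by exact_mod_cast hd
  rw [EuclideanSpace.norm_eq]
  apply Real.sqrt_le_iff.2
  refine ⟨by positivity, ?_⟩
  calc ∑ i, ‖(x - c) i‖ ^ 2 ≤ ∑ i : Fin d, r ^ 2 := by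
        apply Finset.sum_le_sum
        intro i _
        have := hx i
        gcongr
        simpa using this
    _ = d * r ^ 2 := by simp
    _ ≤ (d * r) ^ 2 := by nlinarith [mul_nonneg (sub_nonneg.2 hd') (mul_nonneg (zero_le_one.trans hd') (sq_nonneg r))]

lemma holder_cube {d : ℕ} (hd : 1 ≤ d) {β L : ℝ} (hβ : 0 < β) (hL : 0 < L) {g : Euc d → ℝ}
    (hg : HolderClass β L g) {c x : Euc d} {r : ℝ} (hr : 0 ≤ r) (hx : x ∈ cube c r) :
    |g x - taylorPoly g (⌈β⌉₊ - 1) c x| ≤ (L * (d : ℝ) ^ β) * r ^ β := by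
  refine (hg.2 c x).trans ?_
  rw [mul_assoc, ← Real.mul_rpow (by positivity) hr]
  gcongr
  exact norm_le_of_mem_cube hd hr hx

lemma isCompact_cube {d : ℕ} (c : Euc d) (r : ℝ) (hd : 1 ≤ d) (hr : 0 ≤ r) : IsCompact (cube c r) := by
  apply Metric.isCompact_of_isClosed_isBounded
  · have : cube c r = ⋂ i, {x : Euc d | |x i - c i| ≤ r} := by ext; simp [cube]
    rw [this]
    exact isClosed_iInter fun i => isClosed_le (by fun_prop) continuous_const
  · apply Metric.isBounded_closedBall.subset (s := cube c r) (t := closedBall c (d * r))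
    intro x hx
    rw [mem_closedBall, dist_eq_norm]
    exact norm_le_of_mem_cube hd hr hx

/-- Tuples of homogeneous coefficients. -/
abbrev PolyW (d N : ℕ) := (k : Fin (N + 1)) → (Euc d) [×k]→L[ℝ] ℝ

def polyEval {d N : ℕ} (w : PolyW d N) (y : Euc d) : ℝ := ∑ k, w k (fun _ => y)

lemma polyW_fin (d N : ℕ) : FiniteDimensional ℝ (PolyW d N) := by
  have : ∀ k : Fin (N + 1), FiniteDimensional ℝ ((Euc d) [×k]→L[ℝ] ℝ) := by
    intro k
    exact Module.Finite.of_injective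
      (ContinuousMultilinearMap.toMultilinearMapLinear :
        ((Euc d) [×k]→L[ℝ] ℝ) →ₗ[ℝ] MultilinearMap ℝ (fun _ : Fin k => Euc d) ℝ)
      ContinuousMultilinearMap.toMultilinearMap_injective
  infer_instance

lemma polyEval_cont {d N : ℕ} (w : PolyW d N) : Continuous (polyEval w) := by
  unfold polyEval
  refine continuous_finsetSum _ fun k _ => ?_
  exact (w k).cont.comp (by fun_prop)

def polyMap {d N : ℕ} (S : Set (Euc d)) : PolyW d N →ₗ[ℝ] C(S, ℝ) where
  toFun w := ⟨fun y => polyEval w y, (polyEval_cont w).comp continuous_subtype_val⟩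
  map_add' := by
    intro v w; ext y; simp [polyEval, Finset.sum_add_distrib]
  map_smul' := by
    intro v w; ext y; simp [polyEval, Finset.mul_sum]

lemma polyNet0 (d N : ℕ) (hd : 1 ≤ d) (R : ℝ) : ∃ B : ℕ, ∃ F : Fin (B + 1) → PolyW d N,
    ∀ w : PolyW d N, (∀ y ∈ cube (0 : Euc d) 1, |polyEval w y| ≤ R) →
      ∃ b, ∀ y ∈ cube (0 : Euc d) 1, |polyEval w y - polyEval (F b) y| ≤ 1 := by
  classical
  have hc := isCompact_cube (0 : Euc d) 1 hd zero_le_one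
  have : CompactSpace (cube (0 : Euc d) 1) := isCompact_iff_compactSpace.1 hc
  have := polyW_fin d N
  let Φ : PolyW d N →ₗ[ℝ] C(cube (0 : Euc d) 1, ℝ) := polyMap _
  let V := LinearMap.range Φ
  have : FiniteDimensional ℝ V := inferInstance
  have : ProperSpace V := FiniteDimensional.proper_real V
  obtain ⟨t, -, htf, ht⟩ := (isCompact_closedBall (0 : V) (max R 0)).finite_cover_balls (e := 1) one_pos
  have hpre : ∀ v : V, ∃ w, Φ w = v := fun v => v.2
  choose pre hpre using hpre
  obtain ⟨B, e⟩ : ∃ B, Nonempty (Fin (B + 1) ≃ (insert 0 htf.toFinset : Finset V)) := by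
    refine ⟨(insert 0 htf.toFinset : Finset V).card - 1, ⟨?_⟩⟩
    have : (insert 0 htf.toFinset : Finset V).card - 1 + 1 = (insert 0 htf.toFinset : Finset V).card := by
      have : 0 < (insert 0 htf.toFinset : Finset V).card := Finset.card_pos.2 (by simp)
      omega
    rw [this]
    exact (Finset.equivFin _).symm
  obtain ⟨e⟩ := e
  refine ⟨B, fun b => pre (e b), fun w hw => ?_⟩
  have hmem : (⟨Φ w, ⟨w, rfl⟩⟩ : V) ∈ closedBall (0 : V) (max R 0) := by
    rw [mem_closedBall, dist_zero_right]
    change ‖Φ w‖ ≤ _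
    rw [ContinuousMap.norm_le _ (le_max_right _ _)]
    intro y
    exact (hw y y.2).trans (le_max_left _ _)
  have h2 := ht hmem
  simp only [mem_iUnion] at h2
  obtain ⟨v, hv, hv2⟩ := h2
  refine ⟨e.symm ⟨v, by simp [hv]⟩, fun y hy => ?_⟩
  simp only [Equiv.apply_symm_apply]
  rw [mem_ball, dist_eq_norm] at hv2
  have h3 : ‖Φ w - (v : C(cube (0 : Euc d) 1, ℝ))‖ < 1 := hv2
  rw [← hpre v] at h3
  exact ((ContinuousMap.norm_coe_le_norm (Φ w - Φ (pre v)) ⟨y, hy⟩)).trans h3.le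

lemma taylor_diff {d N : ℕ} (g g1 : Euc d → ℝ) (c : Euc d) {r s : ℝ} (hs : 0 < s) :
    ∃ w : PolyW d N, ∀ y, taylorPoly g N c (c + r • y) - taylorPoly g1 N c (c + r • y) =
      s * polyEval w y := by
  refine ⟨fun k => (s⁻¹ * r ^ (k : ℕ) * ((k : ℕ).factorial : ℝ)⁻¹) •
    (iteratedFDeriv ℝ k g c - iteratedFDeriv ℝ k g1 c), fun y => ?_⟩
  unfold taylorPoly polyEval
  rw [Finset.sum_range, Finset.sum_range, ← Finset.sum_sub_distrib, Finset.mul_sum]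
  refine Finset.sum_congr rfl fun k _ => ?_
  have h : ∀ A : (Euc d) [×k]→L[ℝ] ℝ, A (fun _ => c + r • y - c) = r ^ (k : ℕ) * A (fun _ => y) := by
    intro A
    have := A.map_smul_univ (fun _ => r) (fun _ => y)
    simpa using this
  rw [h, h]
  simp only [_root_.smul_apply, _root_.sub_apply, smul_eq_mul]
  field_simp

lemma polyNet (d N : ℕ) (hd : 1 ≤ d) (R : ℝ) : ∃ B : ℕ, ∀ (c : Euc d) (r s : ℝ), 0 < r → 0 < s →
    ∀ q : Euc d → ℝ, ∃ G : Fin (B + 1) → Euc d → ℝ, ∀ g : Euc d → ℝ,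
      (∀ x ∈ cube c r, |taylorPoly g N c x - q x| ≤ R * s) →
      ∃ b, ∀ x ∈ cube c r, |taylorPoly g N c x - G b x| ≤ s := by
  obtain ⟨B, F, hF⟩ := polyNet0 d N hd (2 * R)
  refine ⟨B, fun c r s hr hs q => ?_⟩
  by_cases hex : ∃ g1 : Euc d → ℝ, ∀ x ∈ cube c r, |taylorPoly g1 N c x - q x| ≤ R * s
  swap
  · exact ⟨fun _ => 0, fun g hg => absurd ⟨g, hg⟩ hex⟩
  obtain ⟨g1, hg1⟩ := hex
  refine ⟨fun b x => taylorPoly g1 N c x + s * polyEval (F b) (r⁻¹ • (x - c)), fun g hg => ?_⟩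
  obtain ⟨w, hw⟩ := taylor_diff (N := N) g g1 c (r := r) hs
  obtain ⟨b, hb⟩ := hF w (by
    intro y hy
    have hx : c + r • y ∈ cube c r := by
      intro i
      have := hy i
      simp only [PiLp.zero_apply, sub_zero] at this
      simp only [PiLp.add_apply, PiLp.smul_apply, smul_eq_mul, add_sub_cancel_left, abs_mul, abs_of_pos hr]
      nlinarith
    have h1 := abs_le.1 (hg _ hx)
    have h2 := abs_le.1 (hg1 _ hx)
    have h3 := hw y
    have h4 : |s * polyEval w y| ≤ s * (2 * R) := by
      rw [← h3, abs_le]; constructor <;> linarith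
    rw [abs_mul, abs_of_pos hs] at h4
    exact le_of_mul_le_mul_left h4 hs)
  refine ⟨b, fun x hx => ?_⟩
  have hy : r⁻¹ • (x - c) ∈ cube (0 : Euc d) 1 := by
    intro i
    have := hx i
    simp only [PiLp.zero_apply, sub_zero, PiLp.sub_apply, PiLp.smul_apply, smul_eq_mul, abs_mul,
      abs_inv, abs_of_pos hr]
    rw [inv_mul_le_iff₀ hr]; linarith
  have h1 := hb _ hy
  have h2 := hw (r⁻¹ • (x - c))
  rw [smul_smul, mul_inv_cancel₀ hr.ne', one_smul, add_sub_cancel] at h2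
  have : taylorPoly g N c x - (taylorPoly g1 N c x + s * polyEval (F b) (r⁻¹ • (x - c))) =
    s * (polyEval w (r⁻¹ • (x - c)) - polyEval (F b) (r⁻¹ • (x - c))) := by linarith
  simp only
  rw [this, abs_mul, abs_of_pos hs]
  nlinarith

def Nseq (d B : ℕ) : ℕ → ℕ
  | 0 => 1
  | j + 1 => ((B + 1) * Nseq d B j) ^ (2 ^ d)

def child {d : ℕ} (c : Euc d) (r : ℝ) (s : Fin d → Bool) : Euc d :=
  WithLp.toLp 2 fun i => c i + (if s i then r / 2 else - (r / 2))

def whichChild {d : ℕ} (c x : Euc d) : Fin d → Bool := fun i => decide (c i ≤ x i)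

lemma mem_child {d : ℕ} {c x : Euc d} {r : ℝ} (hx : x ∈ cube c r) :
    x ∈ cube (child c r (whichChild c x)) (r / 2) := by
  intro i
  have := abs_le.1 (hx i)
  by_cases h : c i ≤ x i
  · simp only [child, whichChild, h, decide_true, if_true]
    rw [abs_le]; constructor <;> linarith
  · simp only [child, whichChild, h, decide_false]
    rw [abs_le]; push Not at h; constructor <;> simp <;> linarith

lemma child_subset {d : ℕ} {c x : Euc d} {r : ℝ} (s) (hx : x ∈ cube (child c r s) (r / 2)) :
    x ∈ cube c r := by
  intro i
  have := abs_le.1 (hx i)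
  simp only [child] at this
  rw [abs_le]
  split_ifs at this <;> constructor <;> linarith

lemma cover {d : ℕ} (hd : 1 ≤ d) {β L : ℝ} (hβ : 0 < β) (hL : 0 < L) : ∃ B : ℕ, ∀ j : ℕ,
    ∀ (c : Euc d) (r : ℝ), 0 < r → ∀ q : Euc d → ℝ, ∃ G : Fin (Nseq d B j) → Euc d → ℝ,
    ∀ g : Euc d → ℝ, HolderClass β L g →
      (∀ x ∈ cube c r, |g x - q x| ≤ 2 * (L * (d : ℝ) ^ β) * r ^ β) →
      ∃ i, ∀ x ∈ cube c r, |g x - G i x| ≤ 2 * (L * (d : ℝ) ^ β) * (r / 2 ^ j) ^ β := by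
  set M := L * (d : ℝ) ^ β with hM
  have hMpos : 0 < M := by
    have : (0 : ℝ) < d := by exact_mod_cast hd
    positivity
  obtain ⟨B, hB⟩ := polyNet d (⌈β⌉₊ - 1) hd (1 + 2 * 2 ^ β)
  refine ⟨B, fun j => ?_⟩
  induction j with
  | zero =>
    intro c r hr q
    refine ⟨fun _ => q, fun g hg h => ⟨⟨0, by simp [Nseq]⟩, fun x hx => ?_⟩⟩
    simpa using h x hx
  | succ j ih =>
    intro c r hr q
    have hr2 : 0 < r / 2 := by positivity
    have hs : 0 < M * (r / 2) ^ β := by positivity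
    choose G1 hG1 using fun s => hB (child c r s) (r / 2) (M * (r / 2) ^ β) hr2 hs q
    choose G2 hG2 using fun s b => ih (child c r s) (r / 2) hr2 (G1 s b)
    have hcard : Fintype.card ((Fin d → Bool) → Fin (B + 1) × Fin (Nseq d B j)) =
      Nseq d B (j + 1) := by simp [Nseq]
    let e := Fintype.equivFinOfCardEq hcard
    refine ⟨fun i x => G2 (whichChild c x) (e.symm i (whichChild c x)).1
      (e.symm i (whichChild c x)).2 x, fun g hg h => ?_⟩
    have key : ∀ s, ∃ b, ∃ i, ∀ x ∈ cube (child c r s) (r / 2), |g x - G2 s b i x| ≤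
        2 * M * (r / 2 / 2 ^ j) ^ β := by
      intro s
      have hr' : r ^ β = 2 ^ β * (r / 2) ^ β := by
        rw [← Real.mul_rpow (by norm_num) hr2.le]; congr 1; ring
      obtain ⟨b, hb⟩ := hG1 s g (by
        intro x hx
        have h1 := abs_le.1 (holder_cube hd hβ hL hg hr2.le hx)
        have h2 := abs_le.1 (h x (child_subset s hx))
        rw [hr'] at h2
        rw [← hM] at h1
        rw [abs_le]
        constructor <;> nlinarith)
      obtain ⟨i, hi⟩ := hG2 s b g hg (by
        intro x hx
        have h1 := abs_le.1 (holder_cube hd hβ hL hg hr2.le hx)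
        have h2 := abs_le.1 (hb x hx)
        rw [← hM] at h1
        rw [abs_le]
        constructor <;> linarith)
      exact ⟨b, i, hi⟩
    choose b i hbi using key
    refine ⟨e fun s => (b s, i s), fun x hx => ?_⟩
    simp only [Equiv.symm_apply_apply]
    have := hbi _ x (mem_child hx)
    convert this using 3
    rw [pow_succ]; field_simp

lemma log_Nseq {d : ℕ} (hd : 1 ≤ d) (B : ℕ) (j : ℕ) :
    0 < Nseq d B j ∧ Real.log (Nseq d B j) ≤ 2 * Real.log (B + 1) * ((2 ^ d) ^ j - 1) := by
  have hD : (2 : ℝ) ≤ 2 ^ d := by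
    calc (2 : ℝ) = 2 ^ 1 := by norm_num
      _ ≤ 2 ^ d := by gcongr; norm_num
  have hb : 0 ≤ Real.log (B + 1) := Real.log_nonneg (by simp)
  induction j with
  | zero => simp [Nseq]
  | succ j ih =>
    obtain ⟨h0, h1⟩ := ih
    refine ⟨by simp only [Nseq]; positivity, ?_⟩
    have h0' : (Nseq d B j : ℝ) ≠ 0 := by exact_mod_cast h0.ne'
    simp only [Nseq]
    push_cast
    rw [Real.log_pow, Real.log_mul (by positivity) h0', pow_succ]
    push_cast
    have : (2:ℝ) ^ d * (Real.log (B + 1) + Real.log (Nseq d B j)) ≤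
      2 ^ d * (Real.log (B + 1) + 2 * Real.log (B + 1) * ((2 ^ d) ^ j - 1)) := by gcongr
    nlinarith

lemma net {d : ℕ} (hd : 1 ≤ d) {β L : ℝ} (hβ : 0 < β) (hL : 0 < L) (K : Set (Euc d))
    (hK : IsCompact K) : ∃ A : ℝ, 0 < A ∧ ∀ ε : ℝ, 0 < ε → ε ≤ 1 →
      ∃ m : ℕ, ∃ G : Fin (m + 1) → Euc d → ℝ, (∀ i, Measurable (G i)) ∧
        Real.log (m + 1) ≤ A * ε ^ (-(d / β)) ∧
        ∀ g, HolderClass β L g → (∀ x, g x ∈ Icc (0 : ℝ) 1) → ∃ i, ∀ x ∈ K, |g x - G i x| ≤ ε := by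
  obtain ⟨B, hB⟩ := cover hd hβ hL
  set M := L * (d : ℝ) ^ β with hM
  have hd0 : (0 : ℝ) < d := by exact_mod_cast hd
  have hMpos : 0 < M := by positivity
  obtain ⟨r1, hr1⟩ := hK.isBounded.exists_norm_le
  set r0 := max (max r1 1) ((1 / (2 * M)) ^ (1 / β)) with hr0
  have hr0pos : 0 < r0 := lt_of_lt_of_le one_pos ((le_max_right _ _).trans (le_max_left _ _))
  have hKr : K ⊆ cube 0 r0 := by
    intro x hx i
    have h1 := hr1 x hx
    have h2 : ‖x i‖ ≤ ‖x‖ := PiLp.norm_apply_le x i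
    simp only [PiLp.zero_apply, sub_zero]
    exact h2.trans (h1.trans ((le_max_left _ _).trans (le_max_left _ _)))
  have hr0M : 1 ≤ 2 * M * r0 ^ β := by
    have : ((1 / (2 * M)) ^ (1 / β)) ^ β ≤ r0 ^ β := by gcongr; exact le_max_right _ _
    rw [← Real.rpow_mul (by positivity), one_div_mul_cancel hβ.ne', Real.rpow_one] at this
    rw [div_le_iff₀ (by positivity)] at this
    linarith
  have hlog : 0 ≤ Real.log (B + 1) := Real.log_nonneg (by simp)
  refine ⟨2 * Real.log (B + 1) * (2 * r0 * (4 * M) ^ (1 / β)) ^ d + 1, by positivity, ?_⟩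
  intro ε hε hε1
  set X := r0 * (4 * M / ε) ^ (1 / β) with hX
  have hXpos : 0 < X := by positivity
  have hXβ : X ^ β = r0 ^ β * (4 * M / ε) := by
    rw [hX, Real.mul_rpow (by positivity) (by positivity), ← Real.rpow_mul (by positivity),
      one_div_mul_cancel hβ.ne', Real.rpow_one]
  have hX1 : 1 ≤ X := by
    have : 1 ≤ X ^ β := by
      rw [hXβ, ← mul_div_assoc, le_div_iff₀ hε]; nlinarith
    by_contra! hlt
    exact absurd (Real.rpow_lt_one hXpos.le hlt hβ) (not_lt.2 this)
  obtain ⟨j, hj1, hj2⟩ := exists_nat_pow_near hX1 (by norm_num : (1 : ℝ) < 2)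
  have hB' := hB (j + 1) 0 r0 hr0pos 0
  have hacc : 2 * M * (r0 / 2 ^ (j + 1)) ^ β ≤ ε / 2 := by
    rw [Real.div_rpow hr0pos.le (by positivity), ← mul_div_assoc, div_le_iff₀ (by positivity)]
    have : X ^ β ≤ (2 ^ (j + 1) : ℝ) ^ β := by gcongr
    rw [hXβ, ← mul_div_assoc, div_le_iff₀ hε] at this
    nlinarith
  obtain ⟨hNpos, hNlog⟩ := log_Nseq hd B (j + 1)
  obtain ⟨m, hm⟩ : ∃ m, Nseq d B (j + 1) = m + 1 := ⟨_, (Nat.succ_pred_eq_of_pos hNpos).symm⟩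
  rw [hm] at hB' hNlog
  obtain ⟨G, hG⟩ := hB'
  classical
  let P : Fin (m + 1) → (Euc d → ℝ) → Prop := fun i g => HolderClass β L g ∧
    ∀ x ∈ cube 0 r0, |g x - G i x| ≤ ε / 2
  refine ⟨m, fun i => if h : ∃ g, P i g then h.choose else 0, ?_, ?_, ?_⟩
  · intro i
    by_cases h : ∃ g, P i g
    · simp only [h, dif_pos]
      exact h.choose_spec.1.1.continuous.measurable
    · simp only [h, dif_neg, not_false_iff]
      exact measurable_const
  · have h1 : ((2 : ℝ) ^ d) ^ (j + 1) ≤ (2 * r0 * (4 * M) ^ (1 / β)) ^ d * ε ^ (-(d / β)) := by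
      calc ((2 : ℝ) ^ d) ^ (j + 1) = (2 * 2 ^ j) ^ d := by rw [← pow_mul, mul_comm, pow_mul]; ring
        _ ≤ (2 * X) ^ d := by gcongr
        _ = _ := by
          have : ε ^ (-(d / β)) = (ε⁻¹ ^ (1 / β)) ^ d := by
            rw [← Real.rpow_natCast, ← Real.rpow_mul (by positivity), Real.rpow_neg hε.le,
              Real.inv_rpow hε.le]
            congr 2; ring
          rw [hX, this, ← mul_pow, div_eq_mul_inv, Real.mul_rpow (by positivity) (by positivity)]
          ring
    push_cast at hNlog
    have h2 : 0 < ε ^ (-(d / β)) := by positivity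
    have h3 : 2 * Real.log (B + 1) * (((2 : ℝ) ^ d) ^ (j + 1) - 1) ≤
      2 * Real.log (B + 1) * ((2 * r0 * (4 * M) ^ (1 / β)) ^ d * ε ^ (-(d / β))) := by
      gcongr; linarith
    nlinarith
  · intro g hg hg01
    obtain ⟨i, hi⟩ := hG g hg (by
      intro x hx
      have := hg01 x
      simp only [Pi.zero_apply, sub_zero]
      rw [abs_of_nonneg this.1]
      exact this.2.trans hr0M)
    have h : ∃ g, P i g := ⟨g, hg, fun x hx => (hi x hx).trans hacc⟩
    refine ⟨i, fun x hx => ?_⟩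
    simp only [h, dif_pos]
    have h1 := abs_le.1 ((hi x (hKr hx)).trans hacc)
    have h2 := abs_le.1 (h.choose_spec.2 x (hKr hx))
    rw [abs_le]; constructor <;> linarith

/-- Three-valued decision with abstention. -/
def tern {d : ℕ} (g : Euc d → ℝ) (ε : ℝ) (x : Euc d) : ℝ :=
  if 4 * ε < 2 * g x - 1 then 1 else if 2 * g x - 1 < -(4 * ε) then -1 else 0

def sgnB (y : Bool) : ℝ := if y then 1 else -1

/-- Loss with a small cost for non-abstention. -/
def tloss {d : ℕ} (ε : ℝ) (T : Euc d → ℝ) (z : Euc d × Bool) : ℝ :=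
  4 * ε * |T z.1| - sgnB z.2 * T z.1

def tdelta {d : ℕ} (η : Euc d → ℝ) (ε : ℝ) (T T0 : Euc d → ℝ) (x : Euc d) : ℝ :=
  (4 * ε * |T x| - (2 * η x - 1) * T x) - (4 * ε * |T0 x| - (2 * η x - 1) * T0 x)

def band {d : ℕ} (η : Euc d → ℝ) (ε : ℝ) : Set (Euc d) :=
  {x | 0 < |η x - 1 / 2| ∧ |η x - 1 / 2| ≤ 3 * ε}

lemma tern_meas {d : ℕ} {g : Euc d → ℝ} (hg : Measurable g) (ε : ℝ) : Measurable (tern g ε) := by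
  unfold tern
  refine Measurable.ite (measurableSet_lt (by fun_prop) (by fun_prop)) (by fun_prop) ?_
  exact Measurable.ite (measurableSet_lt (by fun_prop) (by fun_prop)) (by fun_prop) (by fun_prop)

lemma tern_cases {d : ℕ} (g : Euc d → ℝ) (ε : ℝ) (x : Euc d) :
    tern g ε x = 1 ∨ tern g ε x = -1 ∨ tern g ε x = 0 := by
  unfold tern; split_ifs <;> simp

lemma tloss_meas {d : ℕ} (ε : ℝ) {T : Euc d → ℝ} (hT : Measurable T) : Measurable (tloss ε T) := by
  have : Measurable sgnB := measurable_of_countable _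
  unfold tloss
  have h1 : Measurable fun z : Euc d × Bool => T z.1 := hT.comp measurable_fst
  have h2 : Measurable fun z : Euc d × Bool => sgnB z.2 := this.comp measurable_snd
  exact (measurable_const.mul (h1.abs)).sub (h2.mul h1)

lemma band_meas {d : ℕ} {η : Euc d → ℝ} (hη : Measurable η) (ε : ℝ) : MeasurableSet (band η ε) :=
  (measurableSet_lt measurable_const ((hη.sub_const _).abs)).inter
    (measurableSet_le ((hη.sub_const _).abs) measurable_const)

/-- Pointwise comparison with the reference rule. -/
lemma pointwise_ref {d : ℕ} {η g0 : Euc d → ℝ} {ε : ℝ} (hε : 0 < ε) {x : Euc d}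
    (h0 : |η x - g0 x| ≤ ε) (g : Euc d → ℝ) :
    (2 * ε * (if tern g ε x = tern g0 ε x then 0 else 1) ≤
      tdelta η ε (tern g ε) (tern g0 ε) x + 18 * ε * (band η ε).indicator 1 x) ∧
    ((if decide (tern g ε x = 1) then 1 - η x else η x) - (if bayes η x then 1 - η x else η x) ≤
      3 * tdelta η ε (tern g ε) (tern g0 ε) x + 54 * ε * (band η ε).indicator 1 x) := by
  have h0' := abs_le.1 h0
  have hT := tern_cases g ε x
  have hT0 : (tern g0 ε x = 1 ∧ 2 * ε < 2 * η x - 1) ∨ (tern g0 ε x = -1 ∧ 2 * η x - 1 < - (2 * ε)) ∨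
      (tern g0 ε x = 0 ∧ |2 * η x - 1| ≤ 6 * ε) := by
    unfold tern
    split_ifs with h1 h2
    · left; exact ⟨rfl, by linarith⟩
    · right; left; exact ⟨rfl, by linarith⟩
    · right; right; refine ⟨rfl, ?_⟩
      push Not at h1 h2
      rw [abs_le]; constructor <;> linarith
  have hb : (x ∈ band η ε ∧ |2 * η x - 1| ≤ 6 * ε) ∨ (x ∉ band η ε ∧ η x = 1 / 2) ∨
      (x ∉ band η ε ∧ 6 * ε < 2 * η x - 1) ∨ (x ∉ band η ε ∧ 2 * η x - 1 < - (6 * ε)) := by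
    by_cases hx : x ∈ band η ε
    · left
      refine ⟨hx, ?_⟩
      have := abs_le.1 hx.2
      rw [abs_le]; constructor <;> linarith
    · right
      by_cases he : η x = 1 / 2
      · left; exact ⟨hx, he⟩
      · right
        have h1 : 0 < |η x - 1 / 2| := abs_pos.2 (sub_ne_zero.2 he)
        have h2 : 3 * ε < |η x - 1 / 2| := by
          by_contra! h; exact hx ⟨h1, h⟩
        rcases lt_abs.1 h2 with h | h
        · left; exact ⟨hx, by linarith⟩
        · right; exact ⟨hx, by linarith⟩
  unfold tdelta bayes
  generalize tern g ε x = t at hT ⊢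
  generalize tern g0 ε x = t0 at hT0 ⊢
  generalize η x = e at *
  have hbay : (1 / 2 ≤ e) ∨ ¬ (1 / 2 ≤ e) := em _
  rcases hb with ⟨hb, h6⟩ | ⟨hb, h6⟩ | ⟨hb, h6⟩ | ⟨hb, h6⟩ <;>
    simp only [hb, indicator_of_mem, indicator_of_notMem, not_false_iff, Pi.one_apply]
  · have h6' := abs_le.1 h6
    rcases hT0 with ⟨rfl, h7⟩ | ⟨rfl, h7⟩ | ⟨rfl, h7⟩ <;> rcases hT with rfl | rfl | rfl <;>
      rcases hbay with hbay | hbay <;>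
      simp only [hbay] <;> norm_num <;> (try constructor) <;> linarith
  · subst h6
    rcases hT0 with ⟨rfl, h7⟩ | ⟨rfl, h7⟩ | ⟨rfl, h7⟩
    · linarith
    · linarith
    · rcases hT with rfl | rfl | rfl <;> norm_num <;> (try constructor) <;> linarith
  · have hbay : 1 / 2 ≤ e := by linarith
    rcases hT0 with ⟨rfl, h7⟩ | ⟨rfl, h7⟩ | ⟨rfl, h7⟩
    · rcases hT with rfl | rfl | rfl <;> simp only [hbay] <;> norm_num <;> (try constructor) <;> linarith
    · linarith
    · linarith [(abs_le.1 h7).2]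
  · have hbay : ¬ (1 / 2 ≤ e) := by linarith
    rcases hT0 with ⟨rfl, h7⟩ | ⟨rfl, h7⟩ | ⟨rfl, h7⟩
    · linarith
    · rcases hT with rfl | rfl | rfl <;> simp only [hbay] <;> norm_num <;> (try constructor) <;> linarith
    · linarith [(abs_le.1 h7).1]

lemma exp_le_quad {u μ I : ℝ} (hu : |u| ≤ 3 * I) (hI : I = 0 ∨ I = 1) (hμ : 0 < μ) (hμ1 : μ ≤ 1 / 3) :
    Real.exp (-μ * u) ≤ 1 - μ * u + 9 * μ ^ 2 * I := by
  have hI1 : 0 ≤ I ∧ I ≤ 1 := by rcases hI with h | h <;> simp [h]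
  have hI2 : I ^ 2 = I := by rcases hI with h | h <;> simp [h]
  have h1 : |-μ * u| ≤ 1 := by
    rw [abs_mul, abs_neg, abs_of_pos hμ]
    nlinarith [abs_nonneg u]
  have h2 := (abs_le.1 (Real.abs_exp_sub_one_sub_id_le h1)).2
  have h3 : u ^ 2 ≤ 9 * I := by
    have := sq_le_sq' (by linarith [neg_abs_le u, abs_nonneg u] : -(3 * I) ≤ |u|) hu
    rw [sq_abs] at this
    nlinarith
  nlinarith [mul_le_mul_of_nonneg_left h3 (sq_nonneg μ)]

lemma joint_lintegral {d : ℕ} (PX : Measure (Euc d)) {η : Euc d → ℝ} (hη : Measurable η)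
    {F : Euc d × Bool → ℝ≥0∞} (hF : Measurable F) :
    ∫⁻ z, F z ∂jointLaw PX η = ∫⁻ x, (ENNReal.ofReal (η x) * F (x, true) +
      ENNReal.ofReal (1 - η x) * F (x, false)) ∂PX := by
  unfold jointLaw
  rw [Measure.lintegral_bind _ hF.aemeasurable]
  · refine lintegral_congr fun x => ?_
    rw [lintegral_add_measure, lintegral_smul_measure, lintegral_smul_measure,
      lintegral_dirac' _ hF, lintegral_dirac' _ hF]
    simp
  · refine Measurable.aemeasurable ?_
    refine Measure.measurable_of_measurable_coe _ fun s hs => ?_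
    simp only [Measure.add_apply, Measure.smul_apply, smul_eq_mul, Measure.dirac_apply' _ hs]
    have h : ∀ b : Bool, Measurable fun x : Euc d => s.indicator (1 : Euc d × Bool → ℝ≥0∞) (x, b) := by
      intro b
      exact (measurable_one.indicator hs).comp (by fun_prop)
    exact (hη.ennreal_ofReal.mul (h true)).add ((measurable_const.sub hη).ennreal_ofReal.mul (h false))

lemma joint_prob {d : ℕ} (PX : Measure (Euc d)) [IsProbabilityMeasure PX] {η : Euc d → ℝ}
    (hη : Measurable η) (h01 : ∀ x, η x ∈ Icc (0 : ℝ) 1) : IsProbabilityMeasure (jointLaw PX η) := by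
  constructor
  rw [← lintegral_one]
  refine (joint_lintegral PX hη measurable_one).trans ?_
  have : ∀ x, ENNReal.ofReal (η x) * (1 : Euc d × Bool → ℝ≥0∞) (x, true) +
      ENNReal.ofReal (1 - η x) * (1 : Euc d × Bool → ℝ≥0∞) (x, false) = 1 := by
    intro x
    simp only [Pi.one_apply, mul_one]
    rw [← ENNReal.ofReal_add (h01 x).1 (by linarith [(h01 x).2])]
    simp
  rw [lintegral_congr this]; simp

lemma joint_integral_le {d : ℕ} (PX : Measure (Euc d)) [IsProbabilityMeasure PX] {η : Euc d → ℝ}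
    (hη : Measurable η) (h01 : ∀ x, η x ∈ Icc (0 : ℝ) 1) {F : Euc d × Bool → ℝ} (hF : Measurable F)
    (hF0 : ∀ z, 0 ≤ F z) {H : Euc d → ℝ} (hH : Integrable H PX)
    (hle : ∀ᵐ x ∂PX, η x * F (x, true) + (1 - η x) * F (x, false) ≤ H x) :
    ∫ z, F z ∂jointLaw PX η ≤ ∫ x, H x ∂PX := by
  rw [integral_eq_lintegral_of_nonneg_ae (ae_of_all _ hF0) hF.aestronglyMeasurable,
    joint_lintegral PX hη hF.ennreal_ofReal]
  have hH0 : ∀ᵐ x ∂PX, 0 ≤ H x := by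
    filter_upwards [hle] with x hx
    refine le_trans ?_ hx
    have := h01 x
    have := sub_nonneg.2 this.2
    have := hF0 (x, true)
    have := hF0 (x, false)
    have := (h01 x).1
    positivity
  rw [integral_eq_lintegral_of_nonneg_ae hH0 hH.aestronglyMeasurable]
  refine ENNReal.toReal_mono ?_ (lintegral_mono_ae ?_)
  · rw [← ofReal_integral_eq_lintegral_ofReal hH hH0]; simp
  · filter_upwards [hle] with x hx
    have h1 := sub_nonneg.2 (h01 x).2
    rw [← ENNReal.ofReal_mul (h01 x).1, ← ENNReal.ofReal_mul h1,
      ← ENNReal.ofReal_add (mul_nonneg (h01 x).1 (hF0 _)) (mul_nonneg h1 (hF0 _))]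
    exact ENNReal.ofReal_le_ofReal hx

lemma bdd_integrable {Ω : Type*} [MeasurableSpace Ω] {ν : Measure Ω} [IsFiniteMeasure ν]
    {f : Ω → ℝ} (hf : Measurable f) (C : ℝ) (h : ∀ x, |f x| ≤ C) : Integrable f ν :=
  Integrable.of_bound hf.aestronglyMeasurable C (ae_of_all _ h)

lemma tdelta_meas {d : ℕ} {η : Euc d → ℝ} (hη : Measurable η) (ε : ℝ) {T T0 : Euc d → ℝ}
    (hT : Measurable T) (hT0 : Measurable T0) : Measurable (tdelta η ε T T0) := by
  unfold tdelta
  have := hT.abs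
  have := hT0.abs
  fun_prop

lemma tloss_diff {d : ℕ} {ε : ℝ} (hε : 0 < ε) (hε1 : ε ≤ 1 / 4) (g g0 : Euc d → ℝ)
    (z : Euc d × Bool) : |tloss ε (tern g ε) z - tloss ε (tern g0 ε) z| ≤
      3 * (if tern g ε z.1 = tern g0 ε z.1 then 0 else 1) := by
  unfold tloss
  have hs : sgnB z.2 = 1 ∨ sgnB z.2 = -1 := by unfold sgnB; split_ifs <;> simp
  rcases tern_cases g ε z.1 with h | h | h <;> rcases tern_cases g0 ε z.1 with h' | h' | h' <;>
    rcases hs with hs | hs <;> rw [h, h', hs] <;> norm_num <;> rw [abs_le] <;> constructor <;> linarith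

lemma tdelta_bdd {d : ℕ} {η : Euc d → ℝ} (h01 : ∀ x, η x ∈ Icc (0 : ℝ) 1) {ε : ℝ} (hε : 0 < ε)
    (hε1 : ε ≤ 1 / 4) (g g0 : Euc d → ℝ) (x : Euc d) : |tdelta η ε (tern g ε) (tern g0 ε) x| ≤ 4 := by
  unfold tdelta
  have := (h01 x).1
  have := (h01 x).2
  rcases tern_cases g ε x with h | h | h <;> rcases tern_cases g0 ε x with h' | h' | h' <;>
    rw [h, h'] <;> norm_num <;> rw [abs_le] <;> constructor <;> linarith

lemma exp_moment {d : ℕ} (PX : Measure (Euc d)) [IsProbabilityMeasure PX] {η : Euc d → ℝ}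
    (hη : Measurable η) (h01 : ∀ x, η x ∈ Icc (0 : ℝ) 1) {ε : ℝ} (hε : 0 < ε)
    (hε1 : ε ≤ 1 / 4) {g g0 : Euc d → ℝ} (hg : Measurable g) (hg0 : Measurable g0)
    (h0 : ∀ᵐ x ∂PX, |η x - g0 x| ≤ ε) :
    ∫ z, Real.exp (-(ε / 9) * (tloss ε (tern g ε) z - tloss ε (tern g0 ε) z)) ∂jointLaw PX η ≤
      Real.exp (-(ε / 9) * ((∫ x, tdelta η ε (tern g ε) (tern g0 ε) x ∂PX) / 2 -
        9 * ε * PX.real (band η ε))) := by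
  have hdm := tdelta_meas hη ε (tern_meas hg ε) (tern_meas hg0 ε)
  have hdi : Integrable (tdelta η ε (tern g ε) (tern g0 ε)) PX :=
    bdd_integrable hdm 4 (tdelta_bdd h01 hε hε1 g g0)
  have hbi : Integrable ((band η ε).indicator (1 : Euc d → ℝ)) PX :=
    (integrable_const (1 : ℝ)).indicator (band_meas hη ε)
  have hbv : ∫ x, (band η ε).indicator (1 : Euc d → ℝ) x ∂PX = PX.real (band η ε) :=
    integral_indicator_one (band_meas hη ε)
  have hmain := joint_integral_le PX hη h01
    (F := fun z => Real.exp (-(ε / 9) * (tloss ε (tern g ε) z - tloss ε (tern g0 ε) z)))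
    (Real.measurable_exp.comp (((tloss_meas ε (tern_meas hg ε)).sub
      (tloss_meas ε (tern_meas hg0 ε))).const_mul _)) (fun z => (Real.exp_pos _).le)
    (H := fun x => 1 + ((-(ε / 9) / 2) * tdelta η ε (tern g ε) (tern g0 ε) x +
      (ε / 9 * (9 * ε)) * (band η ε).indicator (1 : Euc d → ℝ) x))
    ((integrable_const _).add ((hdi.const_mul _).add (hbi.const_mul _))) (by
      filter_upwards [h0] with x hx
      have h1 := (pointwise_ref hε hx g).1
      set I : ℝ := (if tern g ε x = tern g0 ε x then 0 else 1) with hI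
      have hI01 : I = 0 ∨ I = 1 := by rw [hI]; split_ifs <;> simp
      have ha := exp_le_quad (tloss_diff hε hε1 g g0 (x, true)) hI01 (by positivity : 0 < ε / 9)
        (by linarith)
      have hb := exp_le_quad (tloss_diff hε hε1 g g0 (x, false)) hI01 (by positivity : 0 < ε / 9)
        (by linarith)
      have hd : tdelta η ε (tern g ε) (tern g0 ε) x =
        η x * (tloss ε (tern g ε) (x, true) - tloss ε (tern g0 ε) (x, true)) +
        (1 - η x) * (tloss ε (tern g ε) (x, false) - tloss ε (tern g0 ε) (x, false)) := by
        simp only [tdelta, tloss, sgnB]; simp; ring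
      have hc := add_le_add (mul_le_mul_of_nonneg_left ha (h01 x).1)
        (mul_le_mul_of_nonneg_left hb (sub_nonneg.2 (h01 x).2))
      have h2 := mul_le_mul_of_nonneg_left h1 (by positivity : 0 ≤ ε / 18)
      refine hc.trans ?_
      have : η x * (1 - ε / 9 * (tloss ε (tern g ε) (x, true) - tloss ε (tern g0 ε) (x, true)) + 9 * (ε / 9) ^ 2 * I) +
        (1 - η x) * (1 - ε / 9 * (tloss ε (tern g ε) (x, false) - tloss ε (tern g0 ε) (x, false)) + 9 * (ε / 9) ^ 2 * I)
        = 1 - ε / 9 * tdelta η ε (tern g ε) (tern g0 ε) x + ε / 18 * (2 * ε * I) := by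
        rw [hd]; ring
      rw [this]
      linarith)
  refine hmain.trans ?_
  have hadd : Integrable (fun x => (-(ε / 9) / 2) * tdelta η ε (tern g ε) (tern g0 ε) x +
      (ε / 9 * (9 * ε)) * (band η ε).indicator (1 : Euc d → ℝ) x) PX :=
    (hdi.const_mul _).add (hbi.const_mul _)
  rw [integral_add (integrable_const _) hadd,
    integral_add (hdi.const_mul _) (hbi.const_mul _), integral_const_mul, integral_const_mul, hbv]
  simp only [integral_const, probReal_univ, smul_eq_mul, mul_one]
  refine le_trans (le_of_eq ?_) (Real.add_one_le_exp _)
  ring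

lemma exists_argmin {Ω ι : Type*} [MeasurableSpace Ω] [Fintype ι] [Nonempty ι] [MeasurableSpace ι]
    [MeasurableSingletonClass ι] (S : ι → Ω → ℝ) (hS : ∀ i, Measurable (S i)) :
    ∃ sel : Ω → ι, Measurable sel ∧ ∀ ω j, S (sel ω) ω ≤ S j ω := by
  classical
  suffices h : ∀ s : Finset ι, s.Nonempty →
      ∃ sel : Ω → ι, Measurable sel ∧ ∀ ω, ∀ j ∈ s, S (sel ω) ω ≤ S j ω by
    obtain ⟨sel, h1, h2⟩ := h Finset.univ Finset.univ_nonempty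
    exact ⟨sel, h1, fun ω j => h2 ω j (Finset.mem_univ _)⟩
  intro s hs
  induction hs using Finset.Nonempty.cons_induction with
  | singleton a => exact ⟨fun _ => a, measurable_const, by simp⟩
  | cons a s ha hs ih =>
    obtain ⟨sel, h1, h2⟩ := ih
    have hm : Measurable fun ω => S (sel ω) ω := by
      have : Measurable fun q : ι × Ω => S q.1 q.2 := measurable_from_prod_countable_right hS
      exact this.comp (h1.prodMk measurable_id)
    refine ⟨fun ω => if S a ω ≤ S (sel ω) ω then a else sel ω,
      Measurable.ite (measurableSet_le (hS a) hm) measurable_const h1, fun ω j hj => ?_⟩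
    rw [Finset.mem_cons] at hj
    by_cases h : S a ω ≤ S (sel ω) ω
    · simp only [h, if_true]
      rcases hj with rfl | hj
      · exact le_rfl
      · exact h.trans (h2 ω j hj)
    · simp only [h, if_false]
      rcases hj with rfl | hj
      · exact (not_le.1 h).le
      · exact h2 ω j hj

lemma fin_integrable {Ω ι : Type*} [MeasurableSpace Ω] [Fintype ι] [MeasurableSpace ι]
    [MeasurableSingletonClass ι] {ν : Measure Ω} [IsFiniteMeasure ν] {sel : Ω → ι}
    (hsel : Measurable sel) (a : ι → ℝ) : Integrable (fun ω => a (sel ω)) ν := by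
  refine bdd_integrable ((measurable_of_countable a).comp hsel) (∑ i, |a i|) fun ω => ?_
  exact Finset.single_le_sum (f := fun i => |a i|) (fun i _ => abs_nonneg _) (Finset.mem_univ _)

lemma erm {Z ι : Type*} [MeasurableSpace Z] [Fintype ι] [Nonempty ι] [MeasurableSpace ι]
    [MeasurableSingletonClass ι] (ν : Measure Z) [IsProbabilityMeasure ν] {n : ℕ} (hn : 1 ≤ n)
    {μ : ℝ} (hμ : 0 < μ) (ℓ : ι → Z → ℝ) (hℓ : ∀ i, Measurable (ℓ i)) (i0 : ι) (a : ι → ℝ)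
    (C : ℝ) (hC : ∀ i z, |ℓ i z - ℓ i0 z| ≤ C)
    (hexp : ∀ i, ∫ z, Real.exp (-μ * (ℓ i z - ℓ i0 z)) ∂ν ≤ Real.exp (-μ * a i))
    (sel : (Fin n → Z) → ι) (hsel : Measurable sel)
    (hmin : ∀ ω j, ∑ k, ℓ (sel ω) (ω k) ≤ ∑ k, ℓ j (ω k)) :
    ∫ ω, a (sel ω) ∂(Measure.pi fun _ : Fin n => ν) ≤ Real.log (Fintype.card ι) / (n * μ) := by
  have hn0 : (0 : ℝ) < n := by exact_mod_cast hn
  have hN : (0 : ℝ) < Fintype.card ι := by exact_mod_cast Fintype.card_pos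
  set N := (Fintype.card ι : ℝ)
  let Φ : ι → (Fin n → Z) → ℝ := fun i ω => ∏ k, Real.exp (-μ * (ℓ i (ω k) - ℓ i0 (ω k)))
  have hint1 : ∀ i, Integrable (fun z => Real.exp (-μ * (ℓ i z - ℓ i0 z))) ν := by
    intro i
    refine bdd_integrable (Real.measurable_exp.comp (((hℓ i).sub (hℓ i0)).const_mul _))
      (Real.exp (μ * C)) fun z => ?_
    rw [abs_of_pos (Real.exp_pos _)]
    apply Real.exp_le_exp.2
    have := (abs_le.1 (hC i z)).1
    nlinarith
  have hΦi : ∀ i, Integrable (Φ i) (Measure.pi fun _ : Fin n => ν) := fun i =>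
    Integrable.fintype_prod (fun _ => hint1 i)
  have hΦ : ∀ i, ∫ ω, Φ i ω ∂(Measure.pi fun _ : Fin n => ν) ≤ Real.exp (-(n * μ * a i)) := by
    intro i
    simp only [Φ]
    rw [integral_fintype_prod_eq_pow (fun z => Real.exp (-μ * (ℓ i z - ℓ i0 z))), Fintype.card_fin]
    calc _ ≤ (Real.exp (-μ * a i)) ^ n := by
          have h0 : 0 ≤ ∫ z, Real.exp (-μ * (ℓ i z - ℓ i0 z)) ∂ν :=
            integral_nonneg fun z => (Real.exp_pos _).le
          exact pow_le_pow_left₀ h0 (hexp i) n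
      _ = _ := by rw [← Real.exp_nat_mul]; congr 1; ring
  have hpt : ∀ ω, n * μ * a (sel ω) - Real.log N ≤
      N⁻¹ * (∑ i, Real.exp (n * μ * a i) * Φ i ω) - 1 := by
    intro ω
    have h1 := Real.add_one_le_exp (n * μ * a (sel ω) - Real.log N)
    have h2 : Real.exp (n * μ * a (sel ω) - Real.log N) = N⁻¹ * Real.exp (n * μ * a (sel ω)) := by
      rw [Real.exp_sub, Real.exp_log hN]; field_simp
    have h3 : Real.exp (n * μ * a (sel ω)) ≤ Real.exp (n * μ * a (sel ω)) * Φ (sel ω) ω := by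
      refine le_mul_of_one_le_right (Real.exp_pos _).le ?_
      simp only [Φ]
      rw [← Real.exp_sum, ← Finset.mul_sum, Finset.sum_sub_distrib]
      apply Real.one_le_exp
      have := hmin ω i0
      nlinarith
    have h4 : Real.exp (n * μ * a (sel ω)) * Φ (sel ω) ω ≤ ∑ i, Real.exp (n * μ * a i) * Φ i ω :=
      Finset.single_le_sum (f := fun i => Real.exp (n * μ * a i) * Φ i ω)
        (fun i _ => mul_nonneg (Real.exp_pos _).le
          (Finset.prod_nonneg fun k _ => (Real.exp_pos _).le)) (Finset.mem_univ _)
    have h5 := mul_le_mul_of_nonneg_left (h3.trans h4) (inv_pos.2 hN).le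
    linarith
  have hsi : Integrable (fun ω => ∑ i, Real.exp (n * μ * a i) * Φ i ω) (Measure.pi fun _ : Fin n => ν) :=
    integrable_finsetSum _ fun i _ => (hΦi i).const_mul _
  have hI : ∫ ω, (n * μ * a (sel ω) - Real.log N) ∂(Measure.pi fun _ : Fin n => ν) ≤
      ∫ ω, (N⁻¹ * (∑ i, Real.exp (n * μ * a i) * Φ i ω) - 1) ∂(Measure.pi fun _ : Fin n => ν) :=
    integral_mono (μ := Measure.pi fun _ : Fin n => ν)
    (((fin_integrable hsel a).const_mul (n * μ)).sub (integrable_const (Real.log N)))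
    ((hsi.const_mul N⁻¹).sub (integrable_const 1)) hpt
  rw [integral_sub ((fin_integrable hsel a).const_mul (n * μ)) (integrable_const _),
    integral_sub (hsi.const_mul N⁻¹) (integrable_const 1), integral_const_mul, integral_const_mul,
    integral_finsetSum _ fun i _ => (hΦi i).const_mul _] at hI
  simp only [integral_const, probReal_univ, smul_eq_mul, one_mul, integral_const_mul] at hI
  have hsum : ∑ i, Real.exp (n * μ * a i) * ∫ ω, Φ i ω ∂(Measure.pi fun _ : Fin n => ν) ≤ N := by
    calc _ ≤ ∑ i : ι, (1 : ℝ) := by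
          refine Finset.sum_le_sum fun i _ => ?_
          have := mul_le_mul_of_nonneg_left (hΦ i) (Real.exp_pos (n * μ * a i)).le
          rwa [← Real.exp_add, add_neg_cancel, Real.exp_zero] at this
      _ = N := by simp [N]
  have h6 := mul_le_mul_of_nonneg_left hsum (inv_pos.2 hN).le
  rw [inv_mul_cancel₀ hN.ne'] at h6
  rw [le_div_iff₀ (by positivity)]
  linarith

/-- Theorem 4.3. Over the class `P_Σ^0` (margin assumption, Hölder
regression function, support of `P_X` in a fixed compact `K`, no density assumption),
there is a classifier achieving the rate `n^{-(1+α)β/((2+α)β+d)}`. -/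
theorem stmt13 (d : ℕ) (hd : 1 ≤ d) (α C0 β L : ℝ) (hα : 0 ≤ α)
    (hC0 : 0 < C0) (hβ : 0 < β) (hL : 0 < L) (K : Set (Euc d)) (hK : IsCompact K) :
    ∃ C' : ℝ, 0 < C' ∧
      ∃ fhat : (n : ℕ) → Sample d n → Euc d → Bool,
        (∀ n, Measurable (Function.uncurry (fhat n))) ∧
        ∀ (PX : Measure (Euc d)) (η : Euc d → ℝ),
          IsProbabilityMeasure PX → Measurable η → (∀ x, η x ∈ Icc (0 : ℝ) 1) →
          Margin PX η α C0 → HolderClass β L η → PX Kᶜ = 0 →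
          ∀ n, 1 ≤ n →
            expExcessRule PX η (fhat n) ≤
              C' * (n : ℝ) ^ (-((1 + α) * β) / ((2 + α) * β + d)) := by
  obtain ⟨A, hA, hnet⟩ := net hd hβ hL K hK
  refine ⟨108 * C0 + 216 * A * 4 ^ ((d : ℝ) / β), by positivity, ?_⟩
  have step : ∀ n : ℕ, ∃ fhat : Sample d n → Euc d → Bool, Measurable (Function.uncurry fhat) ∧
      ∀ (PX : Measure (Euc d)) (η : Euc d → ℝ),
          IsProbabilityMeasure PX → Measurable η → (∀ x, η x ∈ Icc (0 : ℝ) 1) →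
          Margin PX η α C0 → HolderClass β L η → PX Kᶜ = 0 → 1 ≤ n →
            expExcessRule PX η fhat ≤ (108 * C0 + 216 * A * 4 ^ ((d : ℝ) / β)) *
              (n : ℝ) ^ (-((1 + α) * β) / ((2 + α) * β + d)) := by
    intro n
    rcases Nat.eq_zero_or_pos n with hn | hn
    · exact ⟨fun _ _ => false, measurable_const, fun PX η _ _ _ _ _ _ h => by omega⟩
    have hn0 : (0 : ℝ) < n := by exact_mod_cast hn
    have hn1 : (1 : ℝ) ≤ n := by exact_mod_cast hn
    have hd0 : (0 : ℝ) < d := by exact_mod_cast hd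
    have hD : 0 < (2 + α) * β + d := by positivity
    set D := (2 + α) * β + d with hDdef
    set τ : ℝ := (n : ℝ) ^ (-(β / D)) with hτ
    have hτ0 : 0 < τ := by positivity
    have hτ1 : τ ≤ 1 := Real.rpow_le_one_of_one_le_of_nonpos hn1 (by
      have : 0 < β / D := by positivity
      linarith)
    set ε := τ / 4 with hεdef
    have hε : 0 < ε := by positivity
    have hε1 : ε ≤ 1 / 4 := by linarith
    obtain ⟨m, G, hGm, hlog, hG⟩ := hnet ε hε (by linarith)
    obtain ⟨sel, hsel, hmin⟩ := exists_argmin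
      (fun (i : Fin (m + 1)) (ω : Sample d n) => ∑ k, tloss ε (tern (G i) ε) (ω k)) (by
        intro i
        exact Finset.measurable_fun_sum _ fun k _ =>
          (tloss_meas ε (tern_meas (hGm i) ε)).comp (measurable_pi_apply k))
    refine ⟨fun ω x => decide (tern (G (sel ω)) ε x = 1), ?_, ?_⟩
    · have h1 : Measurable fun q : Fin (m + 1) × Euc d => decide (tern (G q.1) ε q.2 = 1) := by
        refine measurable_from_prod_countable_right fun i => ?_
        exact measurable_to_bool (by
          have : (fun x => decide (tern (G i) ε x = 1)) ⁻¹' {true} = tern (G i) ε ⁻¹' {1} := by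
            ext x; simp
          rw [this]
          exact tern_meas (hGm i) ε (measurableSet_singleton _))
      exact h1.comp ((hsel.comp measurable_fst).prodMk measurable_snd)
    intro PX η hPX hη h01 hmar hhol hPK _
    obtain ⟨i0, hi0⟩ := hG η hhol h01
    have hK' : ∀ᵐ x ∂PX, x ∈ K := by rw [ae_iff]; exact hPK
    have h0 : ∀ᵐ x ∂PX, |η x - G i0 x| ≤ ε := by
      filter_upwards [hK'] with x hx using hi0 x hx
    have := joint_prob PX hη h01
    set p := PX.real (band η ε) with hp
    have hpb : p ≤ C0 * τ ^ α := by
      have h1 := hmar (3 * ε) (by positivity)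
      have h2 : p ≤ C0 * (3 * ε) ^ α := by
        rw [hp, measureReal_def]
        exact ENNReal.toReal_le_of_le_ofReal (by positivity) h1
      refine h2.trans ?_
      gcongr
      linarith
    let Δ : Fin (m + 1) → ℝ := fun i => ∫ x, tdelta η ε (tern (G i) ε) (tern (G i0) ε) x ∂PX
    let a : Fin (m + 1) → ℝ := fun i => Δ i / 2 - 9 * ε * p
    have herm := erm (jointLaw PX η) hn (by positivity : 0 < ε / 9)
      (fun i => tloss ε (tern (G i) ε)) (fun i => tloss_meas ε (tern_meas (hGm i) ε)) i0 a 3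
      (by
        intro i z
        refine (tloss_diff hε hε1 (G i) (G i0) z).trans ?_
        split_ifs <;> norm_num)
      (fun i => exp_moment PX hη h01 hε hε1 (hGm i) (hGm i0) h0) sel hsel hmin
    let ρ : Fin (m + 1) → ℝ := fun i => risk PX η fun x => decide (tern (G i) ε x = 1)
    have hρ : ∀ i, ρ i ≤ risk PX η (bayes η) + 6 * a i + 108 * ε * p := by
      intro i
      have hdi : Integrable (tdelta η ε (tern (G i) ε) (tern (G i0) ε)) PX :=
        bdd_integrable (tdelta_meas hη ε (tern_meas (hGm i) ε) (tern_meas (hGm i0) ε)) 4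
          (tdelta_bdd h01 hε hε1 (G i) (G i0))
      have hbi : Integrable ((band η ε).indicator (1 : Euc d → ℝ)) PX :=
        (integrable_const (1 : ℝ)).indicator (band_meas hη ε)
      have hbv : ∫ x, (band η ε).indicator (1 : Euc d → ℝ) x ∂PX = p :=
        integral_indicator_one (band_meas hη ε)
      have hr : ∀ f : Euc d → Bool, MeasurableSet {x | f x = true} →
          Integrable (fun x => if f x then 1 - η x else η x) PX := by
        intro f hf
        refine bdd_integrable (Measurable.ite hf (measurable_const.sub hη) hη) 1 fun x => ?_
        have := h01 x
        rw [abs_le]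
        split_ifs <;> constructor <;> linarith [this.1, this.2]
      have hr1 := hr (fun x => decide (tern (G i) ε x = 1)) (by
        simp only [decide_eq_true_eq]
        exact tern_meas (hGm i) ε (measurableSet_singleton _))
      have hr2 := hr (bayes η) (by
        simp only [bayes, decide_eq_true_eq]
        exact measurableSet_le measurable_const hη)
      have hle : ρ i - risk PX η (bayes η) ≤ 3 * Δ i + 54 * ε * p := by
        simp only [ρ, risk, Δ]
        rw [← integral_sub hr1 hr2, ← hbv, ← integral_const_mul, ← integral_const_mul,
          ← integral_add (hdi.const_mul _) (hbi.const_mul _)]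
        refine integral_mono_ae (hr1.sub hr2) ((hdi.const_mul _).add (hbi.const_mul _)) ?_
        filter_upwards [h0] with x hx
        exact (pointwise_ref hε hx (G i)).2
      simp only [a]
      linarith
    have hprob : IsProbabilityMeasure (sampleLaw PX η n) := by unfold sampleLaw; infer_instance
    have hexc : expExcessRule PX η (fun ω x => decide (tern (G (sel ω)) ε x = 1)) ≤
        6 * (Real.log (m + 1) / (n * (ε / 9))) + 108 * ε * p := by
      unfold expExcessRule
      have h1 : ∫ ω, ρ (sel ω) ∂sampleLaw PX η n ≤
          ∫ ω, (6 * a (sel ω) + (risk PX η (bayes η) + 108 * ε * p)) ∂sampleLaw PX η n := by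
        refine integral_mono (fin_integrable hsel ρ)
          (((fin_integrable hsel a).const_mul 6).add (integrable_const _)) fun ω => ?_
        have := hρ (sel ω)
        simp only
        linarith
      rw [integral_add ((fin_integrable hsel a).const_mul 6) (integrable_const _),
        integral_const_mul] at h1
      simp only [integral_const, probReal_univ, smul_eq_mul, one_mul] at h1
      have h2 : ∫ ω, a (sel ω) ∂sampleLaw PX η n ≤ Real.log (m + 1) / (n * (ε / 9)) := by
        have := herm
        simp only [Fintype.card_fin] at this
        push_cast at this
        exact this
      have h3 : ∫ ω, risk PX η (fun x => decide (tern (G (sel ω)) ε x = 1)) ∂sampleLaw PX η n =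
        ∫ ω, ρ (sel ω) ∂sampleLaw PX η n := rfl
      rw [h3]
      linarith
    refine hexc.trans ?_
    have hrate : (n : ℝ) ^ (-((1 + α) * β) / D) = τ * τ ^ α := by
      rw [hτ, ← Real.rpow_mul hn0.le, ← Real.rpow_add hn0]
      congr 1; field_simp; ring
    have hrate2 : (n : ℝ) ^ (-((1 + α) * β) / D) = τ ^ (-((d : ℝ) / β)) / (n * τ) := by
      rw [eq_div_iff (by positivity)]
      have : (n : ℝ) * τ = (n : ℝ) ^ (1 + -(β / D)) := by
        rw [Real.rpow_add hn0, Real.rpow_one]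
      rw [this, hτ, ← Real.rpow_mul hn0.le, ← Real.rpow_add hn0]
      congr 1; field_simp; rw [hDdef]; ring
    have hb1 : 108 * ε * p ≤ 108 * C0 * (n : ℝ) ^ (-((1 + α) * β) / D) := by
      rw [hrate]
      have hp0 : 0 ≤ p := measureReal_nonneg
      calc 108 * ε * p ≤ 108 * τ * (C0 * τ ^ α) := by
            gcongr
            linarith
        _ = _ := by ring
    have hb2 : 6 * (Real.log (m + 1) / (n * (ε / 9))) ≤
        216 * A * 4 ^ ((d : ℝ) / β) * (n : ℝ) ^ (-((1 + α) * β) / D) := by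
      have he : ε ^ (-((d : ℝ) / β)) = 4 ^ ((d : ℝ) / β) * τ ^ (-((d : ℝ) / β)) := by
        rw [hεdef, Real.div_rpow hτ0.le (by norm_num), Real.rpow_neg (by norm_num : (0 : ℝ) ≤ 4)]
        field_simp
      rw [he] at hlog
      calc 6 * (Real.log (m + 1) / (n * (ε / 9))) ≤
          6 * ((A * (4 ^ ((d : ℝ) / β) * τ ^ (-((d : ℝ) / β)))) / (n * (ε / 9))) := by gcongr
        _ = _ := by
          rw [hrate2, hεdef]; field_simp; ring
    linarith
  choose fhat h1 h2 using step
  exact ⟨fhat, h1, fun PX η a b c e f g n hn => h2 n PX η a b c e f g hn⟩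


end
end
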